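/- arXiv:2410.22714 — 6 statements merged into one kernel-verified Lean document; each statement's English description precedes it below -/
import Mathlib

section
/- For every α ∈ ℤ[i] with α ≡ 1 (mod (1+i)³) there exists a unique pair (m, n) ∈ (ℤ/8ℤ)² such that α ≡ (1−4i)^m · (−1−6i)^n (mod (1+i)⁹); equivalently, the map (ℤ/8ℤ) ⊕ (ℤ/8ℤ) → U₉ sending (m,n) to (1−4i)^m (−1−6i)^n is a group isomorphism, where U₉ := {α ∈ (ℤ[i]/((1+i)⁹))^× : α ≡ 1 (mod (1+i)³)}. -/
noncomputable section

/-- The element `i` of the Gaussian integers `ℤ[i]`. -/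
def ii : GaussianInt := ⟨0, 1⟩

/-- A Gaussian integer is *primary* if it is `≡ 1 (mod (1+i)³)`. -/
def isPrimary (α : GaussianInt) : Prop := (1 + ii) ^ 3 ∣ (α - 1)

/-- The map `(ℤ/8ℤ) ⊕ (ℤ/8ℤ) → ℤ[i]/((1+i)⁹)` sending `(m, n)` to the class of
`(1−4i)^m (−1−6i)^n`. -/
def F (mn : ZMod 8 × ZMod 8) : GaussianInt ⧸ Ideal.span ({(1 + ii) ^ 9} : Set GaussianInt) :=
  Ideal.Quotient.mk _ ((1 - 4 * ii) ^ mn.1.val * (-1 - 6 * ii) ^ mn.2.val)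

/-- Powers of `x + y i`, as pairs of real and imaginary parts. -/
def gaussPow (x y : ℤ) : ℕ → ℤ × ℤ
  | 0 => (1, 0)
  | n + 1 => ((gaussPow x y n).1 * x - (gaussPow x y n).2 * y,
      (gaussPow x y n).1 * y + (gaussPow x y n).2 * x)

/-- Real and imaginary parts of `(1 - 4i)^m (-1 - 6i)^n`. -/
def genProd (m n : ℕ) : ℤ × ℤ :=
  ((gaussPow 1 (-4) m).1 * (gaussPow (-1) (-6) n).1 -
      (gaussPow 1 (-4) m).2 * (gaussPow (-1) (-6) n).2,
    (gaussPow 1 (-4) m).1 * (gaussPow (-1) (-6) n).2 +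
      (gaussPow 1 (-4) m).2 * (gaussPow (-1) (-6) n).1)

theorem mk_pow_eq_gaussPow (x y : ℤ) (n : ℕ) :
    (⟨x, y⟩ : GaussianInt) ^ n = ⟨(gaussPow x y n).1, (gaussPow x y n).2⟩ := by
  induction n with
  | zero => rfl
  | succ n ih =>
    rw [pow_succ, ih]
    ext <;> simp [gaussPow]
    ring

theorem gen_pow_mul_gen_pow (m n : ℕ) :
    (1 - 4 * ii) ^ m * (-1 - 6 * ii) ^ n = ⟨(genProd m n).1, (genProd m n).2⟩ := by
  have h₁ : 1 - 4 * ii = ⟨1, -4⟩ := by ext <;> simp [ii]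
  have h₂ : -1 - 6 * ii = ⟨-1, -6⟩ := by ext <;> simp [ii]
  rw [h₁, h₂, mk_pow_eq_gaussPow, mk_pow_eq_gaussPow]
  ext <;> simp [genProd]
  ring

theorem one_add_ii_pow_three : (1 + ii) ^ 3 = ⟨-2, 2⟩ := by
  ext <;> simp [ii, pow_succ]

theorem one_add_ii_pow_nine : (1 + ii) ^ 9 = ⟨16, 16⟩ := by
  ext <;> simp [ii, pow_succ]

theorem one_add_ii_pow_nine_dvd_iff (z : GaussianInt) :
    (1 + ii) ^ 9 ∣ z ↔ 32 ∣ z.re + z.im ∧ 16 ∣ z.im := by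
  rw [one_add_ii_pow_nine]
  constructor
  · rintro ⟨w, rfl⟩
    simp only [Zsqrtd.re_mul, Zsqrtd.im_mul]
    omega
  · rintro ⟨⟨u, hu⟩, v, hv⟩
    refine ⟨⟨u, v - u⟩, ?_⟩
    ext <;> simp <;> omega

theorem four_dvd_and_two_dvd_of_isPrimary {α : GaussianInt} (h : isPrimary α) :
    4 ∣ α.re + α.im - 1 ∧ 2 ∣ α.im := by
  obtain ⟨w, hw⟩ := h
  rw [one_add_ii_pow_three] at hw
  have hre := congrArg Zsqrtd.re hw
  have him := congrArg Zsqrtd.im hw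
  simp at hre him
  omega

theorem exists_genProd_of_residues :
    ∀ t : Fin 32, ∀ s : Fin 16, (t : ℕ) % 4 = 1 → (s : ℕ) % 2 = 0 →
      ∃ m n : ZMod 8,
        32 ∣ (t : ℤ) - ((genProd m.val n.val).1 + (genProd m.val n.val).2) ∧
        16 ∣ (s : ℤ) - (genProd m.val n.val).2 := by
  decide +kernel

theorem eq_zero_of_genProd_congr_one :
    ∀ m n : ZMod 8, 32 ∣ (genProd m.val n.val).1 + (genProd m.val n.val).2 - 1 →
      16 ∣ (genProd m.val n.val).2 → m = 0 ∧ n = 0 := by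
  decide +kernel

theorem F_eq_mk_iff (mn : ZMod 8 × ZMod 8) (α : GaussianInt) :
    Ideal.Quotient.mk _ α = F mn ↔
      (1 + ii) ^ 9 ∣ (α - (1 - 4 * ii) ^ mn.1.val * (-1 - 6 * ii) ^ mn.2.val) := by
  rw [F, Ideal.Quotient.eq, Ideal.mem_span_singleton]

theorem mk_gen_pow_eq_one_iff (m n : ℕ) :
    Ideal.Quotient.mk (Ideal.span {(1 + ii) ^ 9}) ((1 - 4 * ii) ^ m * (-1 - 6 * ii) ^ n) = 1 ↔
      32 ∣ (genProd m n).1 + (genProd m n).2 - 1 ∧ 16 ∣ (genProd m n).2 := by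
  rw [← map_one (Ideal.Quotient.mk _), Ideal.Quotient.eq, Ideal.mem_span_singleton,
    one_add_ii_pow_nine_dvd_iff, gen_pow_mul_gen_pow]
  simp only [Zsqrtd.re_sub, Zsqrtd.im_sub, Zsqrtd.re_one, Zsqrtd.im_one]
  omega

theorem F_zero : F 0 = 1 := by
  simp [F]

theorem F_add (mn mn' : ZMod 8 × ZMod 8) : F (mn + mn') = F mn * F mn' := by
  have pow_val_add {M : Type} [Monoid M] {x : M} (hx : x ^ 8 = 1) (a b : ZMod 8) :
      x ^ (a + b).val = x ^ a.val * x ^ b.val := by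
    rw [ZMod.val_add, ← pow_add, ← pow_eq_pow_mod _ hx]
  have ha : (Ideal.Quotient.mk (Ideal.span {(1 + ii) ^ 9}) (1 - 4 * ii)) ^ 8 = 1 := by
    simpa using (mk_gen_pow_eq_one_iff 8 0).mpr (by decide +kernel)
  have hb : (Ideal.Quotient.mk (Ideal.span {(1 + ii) ^ 9}) (-1 - 6 * ii)) ^ 8 = 1 := by
    simpa using (mk_gen_pow_eq_one_iff 0 8).mpr (by decide +kernel)
  simp only [F, map_mul, map_pow, Prod.fst_add, Prod.snd_add, pow_val_add ha, pow_val_add hb]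
  exact mul_mul_mul_comm _ _ _ _

theorem eq_zero_of_F_eq_one {mn : ZMod 8 × ZMod 8} (h : F mn = 1) : mn = 0 := by
  rw [F, mk_gen_pow_eq_one_iff] at h
  obtain ⟨h₁, h₂⟩ := eq_zero_of_genProd_congr_one mn.1 mn.2 h.1 h.2
  exact Prod.ext h₁ h₂

theorem F_injective : Function.Injective F := by
  intro mn mn' h
  refine sub_eq_zero.mp (eq_zero_of_F_eq_one ?_)
  rw [sub_eq_add_neg, F_add, h, ← F_add, add_neg_cancel, F_zero]

theorem exists_F_eq_mk_of_isPrimary {α : GaussianInt} (h : isPrimary α) :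
    ∃ mn, Ideal.Quotient.mk _ α = F mn := by
  obtain ⟨h₁, h₂⟩ := four_dvd_and_two_dvd_of_isPrimary h
  obtain ⟨m, n, hm, hn⟩ := exists_genProd_of_residues
    ⟨((α.re + α.im) % 32).toNat, by omega⟩ ⟨(α.im % 16).toNat, by omega⟩
    (by dsimp only; omega) (by dsimp only; omega)
  refine ⟨(m, n), ?_⟩
  rw [F_eq_mk_iff, one_add_ii_pow_nine_dvd_iff, gen_pow_mul_gen_pow]
  simp only [Zsqrtd.re_sub, Zsqrtd.im_sub]
  dsimp only at hm hn
  omega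

/-- **Statement 1.** For every primary `α ∈ ℤ[i]` there is a unique pair
`(m, n) ∈ (ℤ/8ℤ)²` with `α ≡ (1−4i)^m (−1−6i)^n (mod (1+i)⁹)`; equivalently, the map
`(m,n) ↦ (1−4i)^m (−1−6i)^n` is a group isomorphism from `(ℤ/8ℤ) ⊕ (ℤ/8ℤ)` onto the
subgroup `U₉` of classes of primary elements: it is multiplicative, injective, and its image
consists exactly of the classes of primary Gaussian integers. -/
theorem primary_decomposition_mod_nine :
    (∀ mn mn' : ZMod 8 × ZMod 8, F (mn + mn') = F mn * F mn') ∧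
    Function.Injective F ∧
    (∀ α : GaussianInt, isPrimary α →
      ∃! mn : ZMod 8 × ZMod 8,
        (1 + ii) ^ 9 ∣ (α - (1 - 4 * ii) ^ mn.1.val * (-1 - 6 * ii) ^ mn.2.val)) := by
  refine ⟨F_add, F_injective, fun α hα => ?_⟩
  simp only [← F_eq_mk_iff]
  obtain ⟨mn, h⟩ := exists_F_eq_mk_of_isPrimary hα
  exact ⟨mn, h, fun mn' h' => F_injective (h'.symm.trans h)⟩
end
end

section
/- Let α ∈ ℤ[i] be primary and let (m, n) ∈ (ℤ/4ℤ)² be the unique pair with α ≡ (1−4i)^m (−1−6i)^n (mod (1+i)⁷). Write the lifts of m and n to {0,1,2,3} as m = m₀ + 2m₁ and n = n₀ + 2n₁ with m₀, m₁, n₀, n₁ ∈ {0,1}, and set t := 1+i. Then α ≡ 1 + n₀ t³ + m₀ t⁴ + (m₀ + n₁) t⁵ + (m₀ + n₀ + m₁) t⁶ (mod t⁷). -/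
noncomputable section

/-- The element `t = 1 + i` of `ℤ[i]`. -/
def tt : GaussianInt := 1 + ii

theorem tt_pow_seven : tt ^ 7 = ⟨8, -8⟩ := by
  decide

theorem tt_pow_seven_dvd_iff (z : GaussianInt) :
    tt ^ 7 ∣ z ↔ (16 : ℤ) ∣ z.re - z.im ∧ (16 : ℤ) ∣ z.re + z.im := by
  rw [tt_pow_seven]
  constructor
  · rintro ⟨w, rfl⟩
    simp only [Zsqrtd.re_mul, Zsqrtd.im_mul]
    constructor <;> omega
  · rintro ⟨⟨a, ha⟩, ⟨b, hb⟩⟩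
    exact ⟨⟨a, b⟩, by ext <;> simp only [Zsqrtd.re_mul, Zsqrtd.im_mul] <;> omega⟩

/-- The congruence between the multiplicative and the additive expansions in the digits of
`m` and `n`. -/
theorem tt_pow_seven_dvd_expansion_sub (m n : ZMod 4) :
    tt ^ 7 ∣ ((1 - 4 * ii) ^ m.val * (-1 - 6 * ii) ^ n.val
      - (1 + ((n.val % 2 : ℕ) : GaussianInt) * tt ^ 3
      + ((m.val % 2 : ℕ) : GaussianInt) * tt ^ 4
      + ((m.val % 2 + n.val / 2 : ℕ) : GaussianInt) * tt ^ 5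
      + ((m.val % 2 + n.val % 2 + m.val / 2 : ℕ) : GaussianInt) * tt ^ 6)) := by
  rw [tt_pow_seven_dvd_iff]
  revert m n
  decide

/-- **Statement 2.** Let `α ∈ ℤ[i]` be primary and `(m, n) ∈ (ℤ/4ℤ)²` the (unique) pair with
`α ≡ (1−4i)^m (−1−6i)^n (mod (1+i)⁷)`.  Writing the lifts to `{0,1,2,3}` as `m = m₀ + 2m₁`,
`n = n₀ + 2n₁` with `m₀, m₁, n₀, n₁ ∈ {0,1}` (so `m₀ = m.val % 2`, `m₁ = m.val / 2`, etc.),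
we have `α ≡ 1 + n₀ t³ + m₀ t⁴ + (m₀+n₁) t⁵ + (m₀+n₀+m₁) t⁶ (mod t⁷)` where `t = 1+i`. -/
theorem primary_additive_expansion (α : GaussianInt) (hα : tt ^ 3 ∣ (α - 1))
    (m n : ZMod 4)
    (hmn : tt ^ 7 ∣ (α - (1 - 4 * ii) ^ m.val * (-1 - 6 * ii) ^ n.val)) :
    tt ^ 7 ∣ (α - (1 + ((n.val % 2 : ℕ) : GaussianInt) * tt ^ 3
      + ((m.val % 2 : ℕ) : GaussianInt) * tt ^ 4
      + ((m.val % 2 + n.val / 2 : ℕ) : GaussianInt) * tt ^ 5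
      + ((m.val % 2 + n.val % 2 + m.val / 2 : ℕ) : GaussianInt) * tt ^ 6)) := by
  have h := dvd_add hmn (tt_pow_seven_dvd_expansion_sub m n)
  rwa [sub_add_sub_cancel] at h
end
end

section
/- Let π ∈ ℤ[i] be a primary prime and let (m_π, n_π) ∈ (ℤ/4ℤ)² be the unique pair with π ≡ (1−4i)^{m_π} (−1−6i)^{n_π} (mod (1+i)⁷). Then (1+i)^{(Nm(π)−1)/4} ≡ i^{m_π} (mod π) and i^{(Nm(π)−1)/4} ≡ i^{n_π} (mod π); that is, the quartic residue symbols satisfy [(1+i)/π]₄ = i^{m_π} and [i/π]₄ = i^{n_π}. -/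
noncomputable section

theorem ii_mul_ii : ii * ii = -1 := by decide

theorem ii_pow_four : ii ^ 4 = 1 := by decide

/-- The element `i` as a unit of `ℤ[i]`. -/
def iiUnit : GaussianIntˣ := ⟨ii, -ii, by decide, by decide⟩

theorem coe_iiUnit : (iiUnit : GaussianInt) = ii := rfl

theorem iiUnit_pow_four : iiUnit ^ 4 = 1 := Units.ext ii_pow_four

theorem iiUnit_zpow_eq {m n : ℤ} (h : (4 : ℤ) ∣ m - n) : iiUnit ^ m = iiUnit ^ n := by
  obtain ⟨k, hk⟩ := h
  have h4 : iiUnit ^ (4 : ℤ) = 1 := iiUnit_pow_four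
  rw [show m = n + 4 * k by lia, zpow_add, zpow_mul, h4, one_zpow, mul_one]

theorem eq_re_add_im_mul_ii (x : GaussianInt) : x = (x.re : GaussianInt) + x.im * ii := by
  ext <;> simp [ii]

theorem eq_of_pow_four_eq_one {R : Type*} [CommRing R] [IsDomain R] (f : GaussianInt →+* R)
    {x : R} (hx : x ^ 4 = 1) : ∃ u : GaussianIntˣ, u ^ 4 = 1 ∧ f u = x := by
  have hf : f ii * f ii = -1 := by rw [← map_mul, ii_mul_ii, map_neg, map_one]
  have h : (x - 1) * ((x + 1) * ((x - f ii) * (x + f ii))) = 0 := by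
    linear_combination hx - (x ^ 2 - 1) * hf
  rcases mul_eq_zero.1 h with h | h
  · exact ⟨1, one_pow 4, by simp; linear_combination -h⟩
  rcases mul_eq_zero.1 h with h | h
  · exact ⟨-1, by decide, by simp; linear_combination -h⟩
  rcases mul_eq_zero.1 h with h | h
  · exact ⟨iiUnit, iiUnit_pow_four, by rw [coe_iiUnit]; linear_combination -h⟩
  · refine ⟨-iiUnit, by rw [neg_pow, iiUnit_pow_four]; decide, ?_⟩
    rw [Units.val_neg, coe_iiUnit, map_neg]; linear_combination -h

theorem eq_of_map_eq_of_pow_four_eq_one {R : Type*} [CommRing R] [IsDomain R]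
    (f : GaussianInt →+* R) (h2 : (2 : R) ≠ 0) {x y : GaussianInt} (hx : x ^ 4 = 1)
    (hy : y ^ 4 = 1) (hxy : f x = f y) : x = y := by
  have key : ∀ z : GaussianInt, z ^ 4 = 1 → f z = 1 → z = 1 := by
    intro z hz hfz
    have h : (z - 1) * ((z + 1) * (z * z + 1)) = 0 := by linear_combination hz
    have h' : f ((z + 1) * (z * z + 1)) ≠ 0 := by
      simp only [map_mul, map_add, map_one, hfz]
      rw [one_mul, one_add_one_eq_two]
      exact mul_ne_zero h2 h2
    rcases mul_eq_zero.1 h with h | h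
    · exact sub_eq_zero.1 h
    · exact absurd (by rw [h, map_zero]) h'
  have hy' : f y ^ 4 = 1 := by rw [← map_pow, hy, map_one]
  have := key (x * y ^ 3) (by rw [mul_pow, hx, ← pow_mul, mul_comm 3 4, pow_mul, hy]; simp) (by
    rw [map_mul, map_pow, hxy]; linear_combination hy')
  linear_combination y * this - x * hy

/-- In characteristic `q`, the `q`-th power map on the image of `ℤ[i]` is conjugation or trivial,
according to `q` modulo 4. -/
theorem map_pow_char {K : Type*} [CommRing K] (q : ℕ) [Fact q.Prime] [CharP K q]
    (f : GaussianInt →+* K) (x : GaussianInt) :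
    f x ^ q = (x.re : K) + x.im * f ii ^ q := by
  conv_lhs => rw [eq_re_add_im_mul_ii x]
  have h (n : ℤ) : (n : K) ^ q = n := by
    have := map_intCast (frobenius K q) n
    rwa [frobenius_def] at this
  simp only [map_add, map_mul, map_intCast]
  rw [add_pow_char, mul_pow, h, h]

theorem map_pow_char_of_one_mod_four {K : Type*} [CommRing K] {q j : ℕ} [Fact q.Prime]
    [CharP K q] (hq : q = 4 * j + 1) (f : GaussianInt →+* K) (x : GaussianInt) :
    f x ^ q = f x := by
  rw [map_pow_char q f x]
  conv_rhs => rw [eq_re_add_im_mul_ii x]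
  have : f ii ^ q = f ii := by
    rw [← map_pow, hq, pow_succ, pow_mul, ii_pow_four, one_pow, one_mul]
  simp [this]

theorem map_pow_char_of_three_mod_four {K : Type*} [CommRing K] {q j : ℕ} [Fact q.Prime]
    [CharP K q] (hq : q = 4 * j + 3) (f : GaussianInt →+* K) (x : GaussianInt) :
    f x ^ q = f (star x) := by
  rw [map_pow_char q f x]
  conv_rhs => rw [eq_re_add_im_mul_ii (star x)]
  have : f ii ^ q = - f ii := by
    rw [← map_pow, hq, pow_add, pow_mul, ii_pow_four, one_pow, one_mul, ← map_neg]
    congr 1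
  simp [this]

/-- The quartic residue character modulo a prime `p = 4 * k + 1`, with values in `ℤ[i]`, attached
to a ring homomorphism `ℤ[i] → ℤ/pℤ`. -/
theorem exists_quarticChar {p k : ℕ} [Fact p.Prime] (hp : p = 4 * k + 1)
    (φ : GaussianInt →+* ZMod p) :
    ∃ χ : MulChar (ZMod p) GaussianInt, (∀ x, φ (χ x) = x ^ k) ∧ χ ^ 4 = 1 ∧ χ ^ 2 ≠ 1 := by
  obtain ⟨g, hg⟩ := IsCyclic.exists_generator (α := (ZMod p)ˣ)
  have hcard : Fintype.card (ZMod p)ˣ = 4 * k := by rw [ZMod.card_units, hp]; lia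
  have hk : 0 < k := by
    rcases Nat.eq_zero_or_pos k with rfl | h
    · exact absurd hp (Fact.out : p.Prime).ne_one
    · exact h
  obtain ⟨μ, hμ, hμg⟩ := eq_of_pow_four_eq_one φ (x := ((g ^ k : (ZMod p)ˣ) : ZMod p)) (by
    rw [← Units.val_pow_eq_pow_val, ← pow_mul, mul_comm, ← hcard, pow_card_eq_one, Units.val_one])
  have hroot : μ ∈ rootsOfUnity (Fintype.card (ZMod p)ˣ) GaussianInt := by
    rw [mem_rootsOfUnity, hcard, pow_mul, hμ, one_pow]
  have hspec := MulChar.ofRootOfUnity_spec hroot hg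
  set χ := MulChar.ofRootOfUnity hroot hg
  have hχ (x : ZMod p) : φ (χ x) = x ^ k := by
    rcases eq_or_ne x 0 with rfl | hx
    · rw [MulChar.map_zero, map_zero, zero_pow hk.ne']
    · obtain ⟨n, hn⟩ := (mem_powers_iff_mem_zpowers).2 (hg (Units.mk0 x hx))
      have hx' : x = (g : ZMod p) ^ n := by
        have := congrArg Units.val hn
        simpa using this.symm
      rw [hx', map_pow, map_pow, hspec, hμg, Units.val_pow_eq_pow_val, pow_right_comm]
  refine ⟨χ, hχ, ?_, fun h => ?_⟩
  · rw [MulChar.eq_iff hg, MulChar.pow_apply_coe, hspec, MulChar.one_apply_coe]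
    rw [← Units.val_pow_eq_pow_val, hμ, Units.val_one]
  · have h1 : χ (g : ZMod p) ^ 2 = 1 := by
      rw [← MulChar.pow_apply_coe, h, MulChar.one_apply_coe]
    have h2 : g ^ (2 * k) = 1 := by
      apply Units.ext
      rw [mul_comm, pow_mul, Units.val_pow_eq_pow_val, Units.val_pow_eq_pow_val, ← hχ, ← map_pow,
        h1, map_one, Units.val_one]
    have h3 := orderOf_dvd_of_pow_eq_one h2
    rw [orderOf_eq_card_of_forall_mem_zpowers hg, Nat.card_eq_fintype_card, hcard] at h3
    have := Nat.le_of_dvd (by lia) h3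
    lia

theorem sum_pow_mul_one_sub_pow {p k : ℕ} [Fact p.Prime] (hp : 2 * k < p - 1) :
    ∑ x : ZMod p, x ^ k * (1 - x) ^ k = 0 := by
  have h (x : ZMod p) : x ^ k * (1 - x) ^ k =
      ∑ j ∈ Finset.range (k + 1), (-1) ^ j * (k.choose j : ZMod p) * x ^ (k + j) := by
    rw [sub_eq_neg_add, add_pow, Finset.mul_sum]
    refine Finset.sum_congr rfl fun j _ => ?_
    rw [one_pow, neg_pow x]
    ring
  simp_rw [h]
  rw [Finset.sum_comm]
  refine Finset.sum_eq_zero fun j hj => ?_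
  rw [← Finset.mul_sum, FiniteField.sum_pow_lt_card_sub_one, mul_zero]
  rw [ZMod.card]
  have := Finset.mem_range.1 hj
  lia

theorem norm_jacobiSum {p : ℕ} [Fact p.Prime] {χ : MulChar (ZMod p) GaussianInt}
    (hχ2 : χ ^ 2 ≠ 1) : (jacobiSum χ χ).norm = p := by
  have inj := GaussianInt.toComplex_injective
  set θ := χ.ringHomComp GaussianInt.toComplex with hθ
  have hθ2 : θ * θ ≠ 1 := by
    rw [← pow_two, hθ, MulChar.ringHomComp_pow]
    exact (MulChar.ringHomComp_ne_one_iff inj).2 hχ2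
  have hθ1 : θ ≠ 1 := fun h => hθ2 (by rw [h, one_mul])
  have hchar : ringChar ℂ ≠ ringChar (ZMod p) := by
    rw [ZMod.ringChar_zmod_n, (CharP.ringChar_zero_iff_CharZero ℂ).2 inferInstance]
    exact (Fact.out : p.Prime).ne_zero.symm
  have h := jacobiSum_mul_jacobiSum_inv hchar hθ1 hθ1 hθ2
  have hstar : jacobiSum θ⁻¹ θ⁻¹ = (starRingEnd ℂ) (jacobiSum θ θ) := by
    simp only [jacobiSum, map_sum, map_mul, ← MulChar.star_apply', starRingEnd_apply]
  rw [hstar, Complex.mul_conj, hθ, jacobiSum_ringHomComp, ← GaussianInt.intCast_complex_norm,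
    ZMod.card] at h
  exact_mod_cast h

theorem isPrimitiveRoot_ii : IsPrimitiveRoot ii 4 := by
  rw [IsPrimitiveRoot.iff (by norm_num)]
  refine ⟨ii_pow_four, fun l h0 h4 => ?_⟩
  interval_cases l <;> decide

/-- The Jacobi sum of the quartic residue character modulo `π` is `π` up to sign. -/
theorem jacobiSum_sq {p k : ℕ} [Fact p.Prime] (hp : p = 4 * k + 1)
    {φ : GaussianInt →+* ZMod p} {χ : MulChar (ZMod p) GaussianInt}
    (hχ : ∀ x, φ (χ x) = x ^ k) (hχ4 : χ ^ 4 = 1) (hχ2 : χ ^ 2 ≠ 1) {π : GaussianInt}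
    (hπ : ∀ z, φ z = 0 → π ∣ z) (hnorm : π.norm = p) (heven : (2 : ℤ) ∣ π.im) :
    jacobiSum χ χ ^ 2 = π ^ 2 := by
  have hp0 := (Fact.out : p.Prime).two_le
  have hJ0 : φ (jacobiSum χ χ) = 0 := by
    simp only [jacobiSum, map_sum, map_mul, hχ]
    exact sum_pow_mul_one_sub_pow (by lia)
  obtain ⟨w, hw⟩ := hπ _ hJ0
  have hNJ := norm_jacobiSum hχ2
  have hNw : w.norm = 1 := by
    rw [hw, Zsqrtd.norm_mul, hnorm] at hNJ
    exact mul_left_cancel₀ (Nat.cast_ne_zero.2 (by lia)) (hNJ.trans (mul_one _).symm)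
  obtain ⟨z, -, hz⟩ := exists_jacobiSum_eq_neg_one_add (by norm_num) hχ4 hχ4
    (by rw [ZMod.card]; exact ⟨k, by lia⟩) isPrimitiveRoot_ii
  have him := congrArg Zsqrtd.im (hw.symm.trans hz)
  rw [show (ii - 1) ^ 2 = (⟨0, -2⟩ : GaussianInt) by decide] at him
  rw [hw]
  rw [Zsqrtd.norm_def] at hNw hnorm
  obtain ⟨a, b⟩ := π
  obtain ⟨c, d⟩ := w
  simp only [Zsqrtd.im_mul, Zsqrtd.im_add, Zsqrtd.im_neg, Zsqrtd.im_one] at him hNw hnorm heven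
  obtain ⟨e, rfl⟩ := heven
  have hd : d = 0 := by
    by_contra hd
    have hc : c = 0 := by
      have : 0 < d * d := mul_self_pos.2 hd
      nlinarith [mul_self_nonneg c, mul_self_nonneg (c - 1), mul_self_nonneg (c + 1)]
    subst hc
    have hd' : d = 1 ∨ d = -1 := by
      rw [← mul_self_eq_one_iff]; linarith
    have ha : (2 : ℤ) ∣ a := by
      rcases hd' with rfl | rfl <;> lia
    obtain ⟨f, rfl⟩ := ha
    have : (4 : ℤ) * (f * f + e * e) = 4 * k + 1 := by
      rw [hp] at hnorm; push_cast at hnorm; linarith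
    lia
  subst hd
  have hc : c * c = 1 := by linarith
  rw [mul_pow]
  have : (⟨c, 0⟩ : GaussianInt) ^ 2 = 1 := by
    rw [pow_two]; ext <;> simp [hc]
  rw [this, mul_one]

theorem ringHomComp_sq_ne_one {p : ℕ} {K : Type*} [Field K]
    {χ : MulChar (ZMod p) GaussianInt} {ι : GaussianInt →+* K} (h2 : (2 : K) ≠ 0)
    (hχ4 : χ ^ 4 = 1) (hχ2 : χ ^ 2 ≠ 1) :
    χ.ringHomComp ι ^ 2 ≠ 1 := by
  intro h
  refine hχ2 (MulChar.ext fun x => ?_)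
  have h4 : (χ ^ 2) x ^ 4 = 1 := by
    rw [← MulChar.pow_apply_coe, pow_right_comm, hχ4, one_pow, MulChar.one_apply_coe]
  rw [MulChar.one_apply_coe]
  refine eq_of_map_eq_of_pow_four_eq_one ι h2 h4 (one_pow 4) ?_
  rw [← MulChar.ringHomComp_apply, ← MulChar.ringHomComp_pow, h, MulChar.one_apply_coe, map_one]

section GaussSum

variable {p : ℕ} [Fact p.Prime] {K : Type*} [Field K] {χ : MulChar (ZMod p) GaussianInt}
  {ι : GaussianInt →+* K} {ψ : AddChar (ZMod p) K}

theorem gaussSum_pow_four (h2 : (2 : K) ≠ 0) (hχ4 : χ ^ 4 = 1) (hχ2 : χ ^ 2 ≠ 1)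
    (hψ : ψ.IsPrimitive) {π : GaussianInt} (hJ : jacobiSum χ χ ^ 2 = π ^ 2) :
    gaussSum (χ.ringHomComp ι) ψ ^ 4 = ι (π ^ 2) * p := by
  have hθ2 := ringHomComp_sq_ne_one (ι := ι) h2 hχ4 hχ2
  have hθ4 : χ.ringHomComp ι ^ 4 = 1 := by
    rw [MulChar.ringHomComp_pow, hχ4, MulChar.ringHomComp_one]
  have hjac := jacobiSum_ringHomComp χ χ ι
  set θ := χ.ringHomComp ι
  have hquad : (θ ^ 2).IsQuadratic := by
    intro x
    by_cases hx : IsUnit x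
    · right
      obtain ⟨x, rfl⟩ := hx
      rw [← mul_self_eq_one_iff, ← pow_two, ← MulChar.pow_apply_coe, ← pow_mul, hθ4,
        MulChar.one_apply_coe]
    · exact Or.inl (MulChar.map_nonunit _ hx)
  have h1 := gaussSum_sq hθ2 hquad hψ
  have h3 : (θ ^ 2) (-1) = 1 := by
    rw [MulChar.pow_apply' _ two_ne_zero, ← map_pow, neg_one_sq, map_one]
  have h4 := jacobiSum_mul_nontrivial (χ := θ) (φ := θ) (by rwa [← pow_two]) ψ
  rw [h3, ZMod.card, one_mul] at h1
  rw [hjac, ← pow_two, ← pow_two] at h4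
  rw [show 4 = 2 * 2 from rfl, pow_mul, ← h4, mul_pow, h1, ← map_pow, hJ, mul_comm]

variable {q : ℕ} [Fact q.Prime] [CharP K q]

theorem gaussSum_pow_char (hqp : IsUnit (q : ZMod p)) (θ : MulChar (ZMod p) K) :
    gaussSum θ ψ ^ q = (θ ^ q)⁻¹ q * gaussSum (θ ^ q) ψ := by
  rw [gaussSum_frob, AddChar.pow_mulShift, ← hqp.unit_spec, gaussSum_mulShift_eq]

theorem quarticChar_neg_of_three_mod_four {j : ℕ} (hq : q = 4 * j + 3)
    (hqp : IsUnit (q : ZMod p)) (hχ4 : χ ^ 4 = 1)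
    (hχ2 : χ ^ 2 ≠ 1) (hψ : ψ.IsPrimitive) {π : GaussianInt}
    (hJ : jacobiSum χ χ ^ 2 = π ^ 2) :
    ι (χ (-q)) * p = (ι (π ^ 2) * p) ^ (j + 1) := by
  have h2 : (2 : K) ≠ 0 := by
    intro h
    have := (CharP.cast_eq_zero_iff K q 2).1 (by exact_mod_cast h)
    have := Nat.le_of_dvd two_pos this
    lia
  rw [← gaussSum_pow_four h2 hχ4 hχ2 hψ hJ, ← MulChar.ringHomComp_apply]
  have hθ2 := ringHomComp_sq_ne_one (ι := ι) h2 hχ4 hχ2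
  have hθ4 : χ.ringHomComp ι ^ 4 = 1 := by
    rw [MulChar.ringHomComp_pow, hχ4, MulChar.ringHomComp_one]
  set θ := χ.ringHomComp ι
  have hθ1 : θ ≠ 1 := fun h => hθ2 (by rw [h, one_pow])
  have hθq : θ ^ q = θ⁻¹ := by
    rw [hq, pow_add, pow_mul, hθ4, one_pow, one_mul]
    exact eq_inv_of_mul_eq_one_left (by rw [← pow_succ, hθ4])
  have h1 := gaussSum_pow_char (ψ := ψ) hqp θ
  have h3 := gaussSum_mul_gaussSum_eq_card hθ1 hψ
  have h4 := mul_gaussSum_inv_eq_gaussSum θ⁻¹ ψ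
  rw [MulChar.inv_apply', inv_neg_one] at h4
  rw [hθq, inv_inv, ← h4] at h1
  rw [ZMod.card] at h3
  rw [← pow_mul, show 4 * (j + 1) = q + 1 by lia, pow_succ, h1, ← h3, neg_eq_neg_one_mul, map_mul]
  ring

theorem quarticChar_of_one_mod_four {j : ℕ} (hq : q = 4 * j + 1)
    (hqp : IsUnit (q : ZMod p)) (hp0 : (p : K) ≠ 0) (hχ4 : χ ^ 4 = 1)
    (hχ2 : χ ^ 2 ≠ 1) (hψ : ψ.IsPrimitive) {π : GaussianInt}
    (hJ : jacobiSum χ χ ^ 2 = π ^ 2) :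
    ι (χ q) * (ι (π ^ 2) * p) ^ j = 1 := by
  have hq1 : q ≠ 1 := (Fact.out : q.Prime).ne_one
  have h2 : (2 : K) ≠ 0 := by
    intro h
    have := (CharP.cast_eq_zero_iff K q 2).1 (by exact_mod_cast h)
    have := Nat.le_of_dvd two_pos this
    lia
  rw [← gaussSum_pow_four h2 hχ4 hχ2 hψ hJ, ← MulChar.ringHomComp_apply]
  have hθ2 := ringHomComp_sq_ne_one (ι := ι) h2 hχ4 hχ2
  have hθ4 : χ.ringHomComp ι ^ 4 = 1 := by
    rw [MulChar.ringHomComp_pow, hχ4, MulChar.ringHomComp_one]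
  set θ := χ.ringHomComp ι
  have hθ1 : θ ≠ 1 := fun h => hθ2 (by rw [h, one_pow])
  have hg := gaussSum_ne_zero_of_nontrivial (by rwa [ZMod.card]) hθ1 hψ
  have hθq : θ ^ q = θ := by
    rw [hq, pow_succ, pow_mul, hθ4, one_pow, one_mul]
  have h1 := gaussSum_pow_char (ψ := ψ) hqp θ
  rw [hθq] at h1
  have h3 : θ q * θ⁻¹ q = 1 := by
    rw [← MulChar.mul_apply, mul_inv_cancel, MulChar.one_apply hqp]
  refine mul_right_cancel₀ hg ?_
  rw [← pow_mul, mul_assoc, ← pow_succ, ← hq, h1, ← mul_assoc, h3]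

end GaussSum

/-- A primitive additive character of `ℤ/pℤ` together with a homomorphism from `ℤ[i]`, both with
values in a field of characteristic `q`. -/
theorem exists_primitive_addChar (p q : ℕ) [Fact p.Prime] [Fact q.Prime] (hpq : p ≠ q) :
    ∃ (K : Type) (_ : Field K) (_ : CharP K q) (_ : GaussianInt →+* K)
      (ψ : AddChar (ZMod p) K), ψ.IsPrimitive := by
  let L := AlgebraicClosure (ZMod q)
  have hL : ringChar L = q := ringChar.eq_iff.2 inferInstance
  let ψ := AddChar.FiniteField.primitiveChar (ZMod p) L (by
    rw [hL, ZMod.ringChar_zmod_n]; exact hpq.symm)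
  obtain ⟨r, hr⟩ := IsAlgClosed.exists_pow_nat_eq (-1 : L) two_pos
  refine ⟨CyclotomicField ψ.n L, inferInstance, charP_of_injective_algebraMap
    (algebraMap L _).injective q, (algebraMap L _).comp (Zsqrtd.lift ⟨r, ?_⟩), ψ.char, ψ.prim⟩
  rw [← pow_two, hr]; simp

/-- Rational quartic reciprocity for the quartic residue character `χ` attached to a Gaussian prime
`π` of degree one: if `π = c + b * δ`, where `δ` is one of the special elements allowed below, then
`χ` is explicit on the prime divisors of `c`, up to sign. -/
theorem quarticChar_eq_zpow_of_prime {p : ℕ} [Fact p.Prime] {χ : MulChar (ZMod p) GaussianInt}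
    (hχ4 : χ ^ 4 = 1) (hχ2 : χ ^ 2 ≠ 1) {π : GaussianInt} (hnorm : π.norm = p)
    (hJ : jacobiSum χ χ ^ 2 = π ^ 2) {b c : ℤ} {δ e : GaussianInt} {ε : GaussianIntˣ}
    (hπ : π = c + b * δ) (hδ : δ ^ 3 * star δ * ε = e ^ 4) (hδ' : δ * star δ = e * star e)
    (he : e * star e ∣ 2) (hε : ε ^ 4 = 1) {q : ℕ} [Fact q.Prime] (hqc : (q : ℤ) ∣ c)
    (hqp : p ≠ q) {k : ℤ} (hk : (q : ℤ) = 1 + 4 * k ∨ -(q : ℤ) = 1 + 4 * k) :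
    χ ((1 + 4 * k : ℤ) : ZMod p) = ((ε ^ k : GaussianIntˣ) : GaussianInt) := by
  obtain ⟨K, _, _, ι, ψ, hψ⟩ := exists_primitive_addChar p q hqp
  have hqu : IsUnit (q : ZMod p) := by
    rw [isUnit_iff_ne_zero, Ne, ZMod.natCast_eq_zero_iff]
    exact fun h => hqp ((Nat.prime_dvd_prime_iff_eq Fact.out Fact.out).1 h)
  have hp0 : (p : K) ≠ 0 := by
    rw [Ne, CharP.cast_eq_zero_iff K q]
    exact fun h => hqp ((Nat.prime_dvd_prime_iff_eq Fact.out Fact.out).1 h).symm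
  have h2 : (2 : K) ≠ 0 := by
    intro h
    have := (CharP.cast_eq_zero_iff K q 2).1 (by exact_mod_cast h)
    have := Nat.le_of_dvd two_pos this
    have := (Fact.out : q.Prime).two_le
    lia
  have hc : (c : K) = 0 := (CharP.intCast_eq_zero_iff K q c).2 hqc
  have hπK : ι π = b * ι δ := by rw [hπ]; simp [hc]
  have hπK' : ι (star π) = b * ι (star δ) := by rw [hπ]; simp [hc]
  have hpK : (p : K) = ι π * ι (star π) := by
    rw [← map_mul, ← Zsqrtd.norm_eq_mul_conj, hnorm]; simp
  have hb : (b : K) ≠ 0 := by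
    rintro h
    rw [h, zero_mul] at hπK
    rw [hπK, zero_mul] at hpK
    exact hp0 hpK
  have hbq : (b : K) ^ q = b := by
    have := map_intCast (frobenius K q) b
    rwa [frobenius_def] at this
  have heK : ι e * ι (star e) ≠ 0 := by
    obtain ⟨f, hf⟩ := he
    intro h
    have := congrArg ι hf
    rw [map_mul, map_mul, h, zero_mul, map_ofNat] at this
    exact h2 this
  have hδK := congrArg ι hδ
  have hδK' := congrArg ι hδ'
  simp only [map_mul, map_pow] at hδK hδK'
  have hX (x : (ZMod p)ˣ) : χ x ^ 4 = 1 := by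
    rw [← MulChar.pow_apply_coe, hχ4, MulChar.one_apply_coe]
  have hε4 (n : ℤ) : ((ε ^ n : GaussianIntˣ) : GaussianInt) ^ 4 = 1 := by
    rw [← Units.val_pow_eq_pow_val, ← zpow_natCast, zpow_comm, zpow_natCast, hε, one_zpow,
      Units.val_one]
  rcases hk with hk | hk
  · obtain ⟨j, rfl⟩ : ∃ j : ℕ, k = j := ⟨k.toNat, by have := (Fact.out : q.Prime).two_le; lia⟩
    have hqj : q = 4 * j + 1 := by lia
    rw [← hk, Int.cast_natCast]
    refine eq_of_map_eq_of_pow_four_eq_one ι h2 ?_ (hε4 _) ?_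
    · rw [← hqu.unit_spec]; exact hX _
    have key := quarticChar_of_one_mod_four (ι := ι) hqj hqu hp0 hχ4 hχ2 hψ hJ
    have hb4 : ((b : K) ^ 4) ^ j = 1 := by
      refine mul_right_cancel₀ hb ?_
      rw [← pow_mul, ← pow_succ, ← hqj, hbq, one_mul]
    have he4 : (ι e ^ 4) ^ j = 1 := by
      refine mul_right_cancel₀ (left_ne_zero_of_mul heK) ?_
      rw [← pow_mul, ← pow_succ, ← hqj, map_pow_char_of_one_mod_four hqj, one_mul]
    have h5 : (ι (π ^ 2) * p) ^ j * ι ε ^ j = 1 := by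
      rw [← he4, ← hδK, ← mul_pow, hpK, map_pow, hπK, hπK',
        ← one_mul ((ι δ ^ 3 * ι (star δ) * ι ε) ^ j), ← hb4, ← mul_pow]
      congr 1; ring
    rw [zpow_natCast, Units.val_pow_eq_pow_val, map_pow]
    linear_combination ι ε ^ j * key - ι (χ q) * h5
  · obtain ⟨j, rfl⟩ : ∃ j : ℕ, k = -((j + 1 : ℕ) : ℤ) := ⟨(-k - 1).toNat, by
      have := (Fact.out : q.Prime).two_le; lia⟩
    have hqj : q = 4 * j + 3 := by lia
    rw [← hk, Int.cast_neg, Int.cast_natCast]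
    refine eq_of_map_eq_of_pow_four_eq_one ι h2 ?_ (hε4 _) ?_
    · rw [← hqu.unit_spec, ← Units.val_neg]; exact hX _
    have key := quarticChar_neg_of_three_mod_four (ι := ι) hqj hqu hχ4 hχ2 hψ hJ
    have hb4 : ((b : K) ^ 4) ^ (j + 1) = b ^ 2 := by
      rw [← pow_mul, show 4 * (j + 1) = q + 1 by lia, pow_succ, hbq, pow_two]
    have he4 : (ι e ^ 4) ^ (j + 1) = ι e * ι (star e) := by
      rw [← pow_mul, show 4 * (j + 1) = q + 1 by lia, pow_succ,
        map_pow_char_of_three_mod_four hqj, mul_comm]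
    have h5 : (ι (π ^ 2) * p) ^ (j + 1) * ι ε ^ (j + 1) = p := by
      have hpe : (p : K) = (b ^ 4 * (ι δ ^ 3 * ι (star δ) * ι ε)) ^ (j + 1) := by
        rw [mul_pow, hb4, hδK, he4, ← hδK', hpK, hπK, hπK']; ring
      conv_rhs => rw [hpe]
      rw [← mul_pow, hpK, map_pow, hπK, hπK']
      ring
    have h6 : ι (χ (-q)) * ι ε ^ (j + 1) = 1 := by
      refine mul_right_cancel₀ hp0 ?_
      linear_combination ι ε ^ (j + 1) * key + h5
    have h7 : ι ((ε ^ (-((j + 1 : ℕ) : ℤ)) : GaussianIntˣ) : GaussianInt) * ι ε ^ (j + 1) = 1 := by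
      rw [zpow_neg, zpow_natCast, ← map_pow, ← map_mul, ← Units.val_pow_eq_pow_val,
        Units.inv_mul, map_one]
    exact mul_right_cancel₀ (right_ne_zero_of_mul_eq_one h6) (h6.trans h7.symm)

/-- Extension of `quarticChar_eq_zpow_of_prime` to all divisors of `c` congruent to 1 modulo 4. -/
theorem quarticChar_eq_zpow {p : ℕ} [Fact p.Prime] {χ : MulChar (ZMod p) GaussianInt}
    (hχ4 : χ ^ 4 = 1) (hχ2 : χ ^ 2 ≠ 1) {π : GaussianInt} (hnorm : π.norm = p)
    (hJ : jacobiSum χ χ ^ 2 = π ^ 2) {b c : ℤ} {δ e : GaussianInt} {ε : GaussianIntˣ}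
    (hπ : π = c + b * δ) (hδ : δ ^ 3 * star δ * ε = e ^ 4) (hδ' : δ * star δ = e * star e)
    (he : e * star e ∣ 2) (hε : ε ^ 4 = 1) (hpc : ¬ (p : ℤ) ∣ c) (k : ℤ)
    (hk : 1 + 4 * k ∣ c) :
    χ ((1 + 4 * k : ℤ) : ZMod p) = ((ε ^ k : GaussianIntˣ) : GaussianInt) := by
  induction h : (1 + 4 * k).natAbs using Nat.strong_induction_on generalizing k with
  | _ n ih =>
  by_cases hn : n = 1
  · obtain rfl : k = 0 := by lia
    simp
  obtain ⟨q, hq, hqn⟩ := Nat.exists_prime_and_dvd hn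
  have := Fact.mk hq
  have hqk : (q : ℤ) ∣ 1 + 4 * k := Int.natCast_dvd.2 (h ▸ hqn)
  obtain ⟨l, hl⟩ : ∃ l : ℤ, (q : ℤ) = 1 + 4 * l ∨ -(q : ℤ) = 1 + 4 * l := by
    have : (q : ℤ) % 4 = 1 ∨ (q : ℤ) % 4 = 3 := by
      obtain ⟨t, ht⟩ := hqk
      have h1 : q % 2 = 1 := by
        rcases hq.eq_two_or_odd with rfl | h1
        · push_cast at ht; lia
        · exact h1
      lia
    rcases this with h1 | h1
    · exact ⟨(q - 1) / 4, by lia⟩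
    · exact ⟨(-q - 1) / 4, by lia⟩
  have hlk : 1 + 4 * l ∣ 1 + 4 * k := by
    rcases hl with hl | hl <;> rw [← hl]
    · exact hqk
    · exact (neg_dvd).2 hqk
  obtain ⟨t, ht⟩ := hlk
  obtain ⟨m, rfl⟩ : ∃ m, t = 1 + 4 * m := ⟨k - l * t, by linarith⟩
  have hqabs : (1 + 4 * l).natAbs = q := by lia
  have hm := ih (1 + 4 * m).natAbs (by
    rw [← h, ht, Int.natAbs_mul, hqabs]
    have := hq.two_le
    have : 0 < (1 + 4 * m).natAbs := by lia
    nlinarith) m ((Dvd.intro_left _ ht.symm).trans hk) rfl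
  have hl' := quarticChar_eq_zpow_of_prime hχ4 hχ2 hnorm hJ hπ hδ hδ' he hε (hqk.trans hk)
    (fun h => hpc (h ▸ hqk.trans hk)) hl
  have hkl : k = l + m + 4 * (l * m) := by linarith
  have hε' : ε ^ (4 : ℤ) = 1 := hε
  rw [ht, Int.cast_mul, map_mul, hm, hl', hkl, zpow_add, zpow_add, zpow_mul, hε', one_zpow,
    mul_one, Units.val_mul]

/-- Reduction modulo a Gaussian integer `π` of prime norm `p`, as a map onto `ℤ/pℤ`. -/
theorem exists_ringHom_zmod {p : ℕ} [Fact p.Prime] {π : GaussianInt} (hnorm : π.norm = p)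
    (hre : ¬ (p : ℤ) ∣ π.re) :
    ∃ φ : GaussianInt →+* ZMod p, φ π = 0 ∧ ∀ z, φ z = 0 → π ∣ z := by
  have ha : (π.re : ZMod p) ≠ 0 := by rwa [Ne, ZMod.intCast_zmod_eq_zero_iff_dvd]
  have hsum : (π.re : ZMod p) * π.re + π.im * π.im = 0 := by
    rw [Zsqrtd.norm_def] at hnorm
    have := congrArg (Int.cast : ℤ → ZMod p) hnorm
    push_cast at this
    rw [ZMod.natCast_self] at this
    linear_combination this
  have hb : (π.im : ZMod p) ≠ 0 := by
    intro h
    rw [h, mul_zero, add_zero] at hsum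
    exact ha (mul_self_eq_zero.1 hsum)
  have hr : (-(π.re : ZMod p) / π.im) * (-(π.re : ZMod p) / π.im) = ((-1 : ℤ) : ZMod p) := by
    field_simp
    push_cast
    linear_combination hsum
  refine ⟨Zsqrtd.lift ⟨_, hr⟩, ?_, fun z hz => ?_⟩
  · rw [Zsqrtd.lift_apply_apply]
    field_simp
    ring
  · rw [Zsqrtd.lift_apply_apply] at hz
    have hz1 : (z.re : ZMod p) * π.im = z.im * π.re := by
      field_simp at hz
      linear_combination hz
    have hz2 : (z.re : ZMod p) * π.re + z.im * π.im = 0 := by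
      refine (mul_eq_zero.1 (?_ : (π.im : ZMod p) * _ = 0)).resolve_left hb
      linear_combination (π.re : ZMod p) * hz1 + (z.im : ZMod p) * hsum
    obtain ⟨u, hu⟩ := (ZMod.intCast_zmod_eq_zero_iff_dvd (z.re * π.re + z.im * π.im) p).1
      (by push_cast; exact hz2)
    obtain ⟨v, hv⟩ := (ZMod.intCast_zmod_eq_zero_iff_dvd (z.im * π.re - z.re * π.im) p).1
      (by push_cast; linear_combination -hz1)
    have hmul : z * star π = ⟨u, v⟩ * star π * π := by
      rw [mul_assoc, mul_comm (star π), ← Zsqrtd.norm_eq_mul_conj, hnorm]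
      ext <;> simp <;> linarith
    have hs : star π ≠ 0 := by
      intro h
      rw [star_eq_zero] at h
      exact hb (by rw [h]; simp)
    refine ⟨⟨u, v⟩, mul_right_cancel₀ hs ?_⟩
    rw [hmul]; ring

/-- The quartic residue symbol of `1 + i` modulo a primary prime of degree one. -/
theorem dvd_tt_pow_sub_of_norm_prime {p k : ℕ} [Fact p.Prime] (hp : p = 4 * k + 1)
    {π : GaussianInt} (hnorm : π.norm = p) {s l j : ℤ} (heven : (2 : ℤ) ∣ π.im)
    (hs : π.re + π.im = 1 + 4 * s) (hl : π.re = 1 + 4 * l ∧ j = 0 ∨ -π.re = 1 + 4 * l ∧ j = 1) :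
    π ∣ tt ^ k - ((iiUnit ^ (-s - 2 * (k * j) - 2 * l) : GaussianIntˣ) : GaussianInt) := by
  have hnorm' : π.re * π.re + π.im * π.im = p := by
    rw [← hnorm, Zsqrtd.norm_def]; ring
  have hpp : Prime (p : ℤ) := Nat.prime_iff_prime_int.1 Fact.out
  have hsq {x y : ℤ} (h : x * x + y * y = p) : ¬ (p : ℤ) ∣ x := by
    rintro ⟨d, rfl⟩
    have hy : (p : ℤ) ∣ y * y := ⟨1 - d * p * d, by linear_combination h⟩
    obtain ⟨f, rfl⟩ := (hpp.dvd_mul.1 hy).elim id id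
    refine hpp.not_isUnit (isUnit_of_dvd_one ⟨d * d + f * f, mul_left_cancel₀ hpp.ne_zero ?_⟩)
    linear_combination -h
  have hpa := hsq hnorm'
  have hpab : ¬ (p : ℤ) ∣ π.re + π.im := by
    intro h
    have h1 : (p : ℤ) ∣ 2 * (π.re * π.im) := by
      have h2 : 2 * (π.re * π.im) = (π.re + π.im) * (π.re + π.im) - p := by
        linear_combination -hnorm'
      rw [h2]
      exact (h.mul_right _).sub dvd_rfl
    rcases hpp.dvd_mul.1 h1 with h1 | h1
    · have := Int.le_of_dvd two_pos h1
      have := (Fact.out : p.Prime).two_le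
      lia
    · rcases hpp.dvd_mul.1 h1 with h1 | h1
      · exact hpa h1
      · exact hsq (y := π.re) (by linarith) h1
  obtain ⟨φ, hφ, hker⟩ := exists_ringHom_zmod hnorm hpa
  obtain ⟨χ, hχ, hχ4, hχ2⟩ := exists_quarticChar hp φ
  have hJ := jacobiSum_sq hp hχ hχ4 hχ2 hker hnorm heven
  have h1 := quarticChar_eq_zpow hχ4 hχ2 hnorm hJ (δ := ii - 1) (e := 1 + ii) (b := π.im)
    (c := π.re + π.im) (ε := iiUnit⁻¹) (by conv_lhs => rw [eq_re_add_im_mul_ii π]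
                                           push_cast; ring)
    (by decide) (by decide)
    (show (1 + ii) * star (1 + ii) = (2 : GaussianInt) by decide).dvd (by decide) hpab s hs.symm.dvd
  have h2 := quarticChar_eq_zpow hχ4 hχ2 hnorm hJ (δ := ii) (e := 1) (b := π.im)
    (c := π.re) (ε := iiUnit ^ 2) (eq_re_add_im_mul_ii π)
    (by decide) (by decide) ⟨2, by decide⟩ (by decide) hpa l (by
      rcases hl with ⟨h, -⟩ | ⟨h, -⟩ <;> rw [← h]
      exact neg_dvd.2 dvd_rfl)
  replace h1 := congrArg φ h1
  replace h2 := congrArg φ h2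
  rw [hχ] at h1 h2
  have hφ' : (π.re : ZMod p) + π.im * φ ii = 0 := by
    rw [← hφ]; conv_rhs => rw [eq_re_add_im_mul_ii π]
    simp
  have hii : φ ii * φ ii = -1 := by rw [← map_mul, ii_mul_ii, map_neg, map_one]
  have htt : ((π.re + π.im : ℤ) : ZMod p) = φ tt * π.re := by
    rw [tt, map_add, map_one]; push_cast
    linear_combination π.im * hii - φ ii * hφ'
  rw [← hs, htt, mul_pow] at h1
  have h3 : (π.re : ZMod p) ^ k = φ ((iiUnit ^ (2 * (k * j) + 2 * l) : GaussianIntˣ)) := by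
    rcases hl with ⟨h, rfl⟩ | ⟨h, rfl⟩
    · rw [h, h2, mul_zero, mul_zero, zero_add, zpow_mul]; rfl
    · rw [← neg_neg π.re, h, Int.cast_neg, neg_pow, h2, mul_one, zpow_add, zpow_mul, zpow_mul,
        zpow_natCast, Units.val_mul, map_mul, Units.val_pow_eq_pow_val, map_pow]
      congr 2
      rw [show ((iiUnit ^ (2 : ℤ) : GaussianIntˣ) : GaussianInt) = -1 by decide]
      simp
  apply hker
  rw [map_sub, map_pow, sub_eq_zero]
  refine mul_right_cancel₀ (b := (π.re : ZMod p) ^ k) ?_ ?_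
  · rw [h3]; exact ((Units.isUnit _).map φ).ne_zero
  · rw [h1, h3, ← map_mul, ← Units.val_mul, ← zpow_add, inv_zpow']
    congr 3; ring

/-- The quartic residue symbol of `1 + i` modulo a primary inert prime. -/
theorem dvd_tt_pow_sub_of_inert {p j : ℕ} [Fact p.Prime] (hp : p = 4 * j + 3)
    {π : GaussianInt} (hπ : Prime π) (hπp : π = -(p : GaussianInt)) :
    π ∣ tt ^ ((p * p - 1) / 4) - ((iiUnit ^ (-(j + 1 : ℤ)) : GaussianIntˣ) : GaussianInt) := by
  let I := Ideal.span {π}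
  have : I.IsPrime := (Ideal.span_singleton_prime hπ.ne_zero).2 hπ
  let f := Ideal.Quotient.mk I
  have hpf : (p : GaussianInt ⧸ I) = 0 := by
    have : f p = 0 := Ideal.Quotient.eq_zero_iff_mem.2
      (Ideal.mem_span_singleton.2 (by rw [hπp]; exact neg_dvd.2 dvd_rfl))
    rwa [map_natCast] at this
  have : CharP (GaussianInt ⧸ I) p := by
    have h1 := CharP.ringChar_of_prime_eq_zero (Fact.out : p.Prime) hpf
    exact ringChar.of_eq h1
  have h2 : f tt ≠ 0 := by
    intro h
    have h3 : f 2 = 0 := by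
      rw [show (2 : GaussianInt) = tt * star tt by decide, map_mul, h, zero_mul]
    rw [map_ofNat] at h3
    have h4 := (CharP.cast_eq_zero_iff (GaussianInt ⧸ I) p 2).1 (by exact_mod_cast h3)
    have := Nat.le_of_dvd two_pos h4
    lia
  rw [← Ideal.mem_span_singleton, ← Ideal.Quotient.eq_zero_iff_mem]
  change f _ = 0
  rw [map_sub, sub_eq_zero]
  refine mul_right_cancel₀ (pow_ne_zero (j + 1) h2) ?_
  have hexp : (p * p - 1) / 4 + (j + 1) = p * (j + 1) := by
    have : p * p - 1 = 4 * ((4 * j + 2) * (j + 1)) := by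
      rw [hp, Nat.sub_eq_iff_eq_add (by nlinarith)]; ring
    rw [this, Nat.mul_div_cancel_left _ (by norm_num), hp]; ring
  rw [map_pow, ← pow_add, hexp, pow_mul, map_pow_char_of_three_mod_four hp, ← map_pow, ← map_pow,
    ← map_mul, zpow_neg, ← inv_zpow, show (j + 1 : ℤ) = ((j + 1 : ℕ) : ℤ) by push_cast; rfl,
    zpow_natCast, Units.val_pow_eq_pow_val, ← mul_pow]
  congr 2

/-- A Gaussian prime divides a rational prime `p`, and its norm is `p` or `p ^ 2`. -/
theorem norm_prime_or_norm_sq {π : GaussianInt} (hπ : Prime π) :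
    ∃ p : ℕ, p.Prime ∧ π ∣ p ∧ (π.norm = p ∨ π.norm = p * p) := by
  have hdvd : π ∣ (π.norm.natAbs : GaussianInt) := by
    rw [GaussianInt.natCast_natAbs_norm, Zsqrtd.norm_eq_mul_conj]
    exact dvd_mul_right _ _
  have hone : π.norm.natAbs ≠ 1 := fun h => hπ.not_isUnit (Zsqrtd.norm_eq_one_iff.1 h)
  have hex : ∀ n : ℕ, n ≠ 0 → π ∣ (n : GaussianInt) → ∃ p : ℕ, p.Prime ∧ π ∣ p := by
    intro n
    induction n using Nat.recOnMul with
    | zero => exact fun h => absurd rfl h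
    | one => exact fun _ h => absurd (isUnit_of_dvd_one (by simpa using h)) hπ.not_isUnit
    | prime p hp => exact fun _ h => ⟨p, hp, h⟩
    | mul a b iha ihb =>
      intro h0 h
      rw [Nat.cast_mul] at h
      rcases hπ.dvd_mul.1 h with h | h
      · exact iha (left_ne_zero_of_mul h0) h
      · exact ihb (right_ne_zero_of_mul h0) h
  obtain ⟨p, hp, hπp⟩ := hex _ (fun h => hπ.ne_zero
    (GaussianInt.norm_eq_zero.1 (Int.natAbs_eq_zero.1 h))) hdvd
  refine ⟨p, hp, hπp, ?_⟩
  obtain ⟨w, hw⟩ := hπp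
  have hN := congrArg (fun z => (Zsqrtd.norm z).natAbs) hw
  simp only [Zsqrtd.norm_natCast, Zsqrtd.norm_mul, Int.natAbs_mul, Int.natAbs_natCast] at hN
  have := (Nat.dvd_prime_pow hp).1 (show π.norm.natAbs ∣ p ^ 2 from ⟨_, by rw [← hN, pow_two]⟩)
  obtain ⟨m, hm, h⟩ := this
  have habs := GaussianInt.abs_natCast_norm π
  interval_cases m
  · exact absurd (by simpa using h) hone
  · left; rw [← habs, h]; simp
  · right; rw [← habs, h]; push_cast; ring

/-- The congruence conditions satisfied by the coordinates of a primary Gaussian integer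
in terms of its exponents modulo `(1 + i) ^ 7`. -/
theorem exponents_congr {π : GaussianInt} (m n : ZMod 4)
    (hmn : tt ^ 7 ∣ (π - (1 - 4 * ii) ^ m.val * (-1 - 6 * ii) ^ n.val)) {k : ℤ}
    (hk : 4 * k + 1 = π.norm) :
    4 ∣ k - n.val ∧
    (∀ s l j : ℤ, π.re + π.im = 1 + 4 * s →
      (π.re = 1 + 4 * l ∧ j = 0 ∨ -π.re = 1 + 4 * l ∧ j = 1) →
        4 ∣ -s - 2 * (k * j) - 2 * l - m.val) ∧
    ∀ j : ℤ, π.im = 0 → π.re = -(4 * j + 3) → 4 ∣ -(j + 1) - (m.val : ℤ) := by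
  obtain ⟨⟨x, y⟩, hxy⟩ := hmn
  rw [show tt ^ 7 = ⟨8, -8⟩ by decide] at hxy
  set c := (1 - 4 * ii) ^ m.val * (-1 - 6 * ii) ^ n.val with hc
  have hre := congrArg Zsqrtd.re hxy
  have him := congrArg Zsqrtd.im hxy
  simp only [Zsqrtd.re_sub, Zsqrtd.im_sub, Zsqrtd.re_mul, Zsqrtd.im_mul] at hre him
  rw [Zsqrtd.norm_def] at hk
  generalize π.re = a at *
  generalize π.im = b at *
  obtain ⟨t, ht⟩ : ∃ t, 4 * k + 1 = c.re * c.re + c.im * c.im + 16 * t := by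
    obtain rfl : a = c.re + 8 * (x + y) := by linarith
    obtain rfl : b = c.im + 8 * (y - x) := by linarith
    exact ⟨c.re * (x + y) + c.im * (y - x) + 4 * (x + y) ^ 2 + 4 * (y - x) ^ 2, by
      rw [hk]; ring⟩
  clear hxy hk
  clear_value c
  fin_cases m <;> fin_cases n <;>
    (rw [hc] at hre him ht
     clear hc
     simp [pow_succ, ii, ZMod.val] at hre him ht ⊢
     refine ⟨?_, ?_, ?_⟩
     · lia
     · rintro s l j hs (⟨hl, rfl⟩ | ⟨hl, rfl⟩) <;> lia
     · lia)

theorem ii_pow_eq {k : ℕ} {z : ℤ} (h : 4 ∣ (k : ℤ) - z) :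
    ii ^ k = ((iiUnit ^ z : GaussianIntˣ) : GaussianInt) := by
  rw [← iiUnit_zpow_eq h, zpow_natCast, Units.val_pow_eq_pow_val, coe_iiUnit]

/-- A primary Gaussian prime whose norm is the square of a prime `p` equals `-p`, and
`p ≡ 3 (mod 4)`. -/
theorem eq_neg_prime_of_norm_sq {p : ℕ} (hp : p.Prime) {π : GaussianInt} (hπ : Prime π)
    (hdvd : π ∣ (p : GaussianInt)) (hnorm : π.norm = p * p) {s : ℤ} (heven : 2 ∣ π.im)
    (hs : π.re + π.im = 1 + 4 * s) :
    ∃ j : ℕ, p = 4 * j + 3 ∧ π = -(p : GaussianInt) := by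
  have : Fact p.Prime := ⟨hp⟩
  obtain ⟨w, hw⟩ := hdvd
  have hp0 : (p : ℤ) ≠ 0 := Int.natCast_ne_zero.2 hp.ne_zero
  have hN := congrArg Zsqrtd.norm hw
  rw [Zsqrtd.norm_natCast, Zsqrtd.norm_mul, hnorm] at hN
  have hw1 : w.norm = 1 := mul_left_cancel₀ (mul_ne_zero hp0 hp0) (by linarith)
  have hwu : IsUnit w := Zsqrtd.norm_eq_one_iff.1 (by rw [hw1]; rfl)
  have hpπ : Prime (p : GaussianInt) := by
    rw [hw]; exact (associated_mul_unit_right π w hwu).prime hπ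
  have hp4 := GaussianInt.mod_four_eq_three_of_nat_prime_of_prime p hpπ
  have hπw : π = p * star w := by
    rw [hw, mul_assoc, ← Zsqrtd.norm_eq_mul_conj, hw1]; simp
  have hre : π.re = p * w.re := by rw [hπw]; simp
  have him : π.im = -(p * w.im) := by rw [hπw]; simp
  rw [Zsqrtd.norm_def] at hw1
  have h1 : w.re = 0 ∨ w.re = 1 ∨ w.re = -1 := by
    have : w.re ≤ 1 := by nlinarith [mul_self_nonneg w.im]
    have : -1 ≤ w.re := by nlinarith [mul_self_nonneg w.im]
    lia
  refine ⟨p / 4, by lia, ?_⟩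
  rcases h1 with h | h | h <;> rw [h] at hre hw1
  · lia
  · have : w.im = 0 := by nlinarith
    rw [this] at him
    lia
  · have : w.im = 0 := by nlinarith
    rw [this] at him
    ext <;> simp [hre, him]

/-- **Statement 3.** Let `π ∈ ℤ[i]` be a primary prime and `(m_π, n_π) ∈ (ℤ/4ℤ)²` the
(unique) pair with `π ≡ (1−4i)^{m_π} (−1−6i)^{n_π} (mod (1+i)⁷)`.  Then the quartic residue
symbols of `1+i` and `i` modulo `π` are `i^{m_π}` and `i^{n_π}` respectively, i.e.
`(1+i)^{(Nm(π)−1)/4} ≡ i^{m_π} (mod π)` and `i^{(Nm(π)−1)/4} ≡ i^{n_π} (mod π)`. -/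
theorem quartic_symbol_special_values (π : GaussianInt) (hπ : Prime π)
    (hprimary : tt ^ 3 ∣ (π - 1)) (m n : ZMod 4)
    (hmn : tt ^ 7 ∣ (π - (1 - 4 * ii) ^ m.val * (-1 - 6 * ii) ^ n.val)) :
    π ∣ (tt ^ ((π.norm.natAbs - 1) / 4) - ii ^ m.val) ∧
    π ∣ (ii ^ ((π.norm.natAbs - 1) / 4) - ii ^ n.val) := by
  obtain ⟨⟨u, v⟩, huv⟩ := hprimary
  rw [show tt ^ 3 = ⟨-2, 2⟩ by decide] at huv
  have hre := congrArg Zsqrtd.re huv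
  have him := congrArg Zsqrtd.im huv
  simp only [Zsqrtd.re_sub, Zsqrtd.im_sub, Zsqrtd.re_mul, Zsqrtd.im_mul, Zsqrtd.re_one,
    Zsqrtd.im_one] at hre him
  have heven : (2 : ℤ) ∣ π.im := by lia
  have hs : π.re + π.im = 1 + 4 * -v := by lia
  obtain ⟨k, hk⟩ : ∃ k : ℕ, π.norm = 4 * k + 1 := by
    obtain ⟨d, hd⟩ : ∃ d : ℤ, π.norm = 4 * d + 1 := by
      rw [Zsqrtd.norm_def]
      have h1 : π.re = 1 - 2 * u - 2 * v := by lia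
      have h2 : π.im = 2 * u - 2 * v := by lia
      exact ⟨2 * u ^ 2 + 2 * v ^ 2 - u - v, by rw [h1, h2]; ring⟩
    have := GaussianInt.norm_nonneg π
    exact ⟨d.toNat, by lia⟩
  have hk' : (π.norm.natAbs - 1) / 4 = k := by lia
  obtain ⟨hn, hsplit, hinert⟩ := exponents_congr m n hmn hk.symm
  rw [hk']
  refine ⟨?_, ?_⟩
  · have hm : ii ^ m.val = ((iiUnit ^ (m.val : ℤ) : GaussianIntˣ) : GaussianInt) :=
      ii_pow_eq (by simp)
    rw [hm]
    obtain ⟨p, hp, hdvd, hnorm | hnorm⟩ := norm_prime_or_norm_sq hπ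
    · have : Fact p.Prime := ⟨hp⟩
      obtain ⟨l, j, hl⟩ : ∃ l j : ℤ,
          π.re = 1 + 4 * l ∧ j = 0 ∨ -π.re = 1 + 4 * l ∧ j = 1 := by
        rcases (by lia : π.re % 4 = 1 ∨ π.re % 4 = 3) with h | h
        · exact ⟨π.re / 4, 0, Or.inl ⟨by lia, rfl⟩⟩
        · exact ⟨-π.re / 4, 1, Or.inr ⟨by lia, rfl⟩⟩
      rw [← iiUnit_zpow_eq (hsplit _ l j hs hl)]
      exact dvd_tt_pow_sub_of_norm_prime (by lia) hnorm heven hs hl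
    · have : Fact p.Prime := ⟨hp⟩
      obtain ⟨j, hj, hπp⟩ := eq_neg_prime_of_norm_sq hp hπ hdvd hnorm heven hs
      rw [← iiUnit_zpow_eq (hinert j (by rw [hπp]; simp) (by rw [hπp, hj]; simp)), ← hk', hnorm,
        ← Nat.cast_mul, Int.natAbs_natCast]
      exact dvd_tt_pow_sub_of_inert hj hπ hπp
  · rw [ii_pow_eq hn, ii_pow_eq (k := n.val) (z := n.val) (by simp), sub_self]
    exact dvd_zero π
end
end

section
/- (Multivariable Hensel's Lemma.) Let K be a field that is complete with respect to a nonarchimedean absolute value |·|, and let A := {x ∈ K : |x| ≤ 1} be its ring of integers. Let f ∈ A[X₁, …, Xₙ] be a polynomial in n variables and suppose a = (a₁, …, aₙ) ∈ Aⁿ satisfies |f(a)| < (max_{1 ≤ i ≤ n} |∂f/∂X_i(a)|)². Then there exists α = (α₁, …, αₙ) ∈ Aⁿ such that f(α) = 0 and max_{1 ≤ i ≤ n} |α_i − a_i| < max_{1 ≤ i ≤ n} |∂f/∂X_i(a)|. -/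
open MvPolynomial

/-- Varying one coordinate of a polynomial: the difference quotient agrees with the partial
derivative up to an explicit combination of the displacements. -/
theorem MvPolynomial.exists_eval_update_sub_eq {R σ : Type*} [CommRing R] [DecidableEq σ]
    (f : MvPolynomial σ R) (a : σ → R) (i : σ) (s t : R) :
    ∃ u v : R, eval (Function.update a i t) f - eval (Function.update a i s) f =
      (t - s) * (eval a (pderiv i f) + u * (t - a i) + v * (s - a i)) := by
  induction f using MvPolynomial.induction_on generalizing s t with
  | C c => exact ⟨0, 0, by simp⟩
  | add p q hp hq =>
    obtain ⟨u, v, h⟩ := hp s t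
    obtain ⟨u', v', h'⟩ := hq s t
    refine ⟨u + u', v + v', ?_⟩
    simp only [map_add]
    linear_combination h + h'
  | mul_X p j hp =>
    obtain ⟨u, v, h⟩ := hp s t
    by_cases hj : j = i
    · subst hj
      obtain ⟨u', v', h'⟩ := hp (a j) s
      rw [Function.update_eq_self] at h'
      refine ⟨eval a (pderiv j p) + t * u,
        t * v + (eval a (pderiv j p) + u' * (s - a j) + v' * (a j - a j)), ?_⟩
      simp only [map_mul, eval_X, Function.update_self, Derivation.leibniz, pderiv_X_self,
        map_add, smul_eq_mul, map_one]
      linear_combination t * h + (t - s) * h'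
    · refine ⟨a j * u, a j * v, ?_⟩
      simp only [map_mul, eval_X, Function.update_of_ne hj, Derivation.leibniz,
        pderiv_X_of_ne hj, map_add, smul_eq_mul, map_zero]
      linear_combination a j * h

open NormedField in
/-- Ultrametric estimate for a polynomial with integral coefficients when one coordinate varies in
a ball around an integral point, together with integrality of the partial derivative. -/
theorem MvPolynomial.norm_eval_update_sub_le {K σ : Type*} [NormedField K] [IsUltrametricDist K]
    [DecidableEq σ] (f : MvPolynomial σ K) (hf : ∀ m, ‖f.coeff m‖ ≤ 1) (a : σ → K)
    (ha : ∀ i, ‖a i‖ ≤ 1) (i : σ) :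
    ‖eval a (pderiv i f)‖ ≤ 1 ∧ ∀ (r : ℝ) (s t : K), r ≤ 1 → ‖s - a i‖ ≤ r → ‖t - a i‖ ≤ r →
      ‖eval (Function.update a i t) f - eval (Function.update a i s) f -
        (t - s) * eval a (pderiv i f)‖ ≤ r * ‖t - s‖ := by
  let A : Subring K := (valuation (K := K)).integer
  have memA (x : K) : x ∈ A ↔ ‖x‖ ≤ 1 := by
    simp only [A, Valuation.mem_integer_iff, valuation_apply, ← NNReal.coe_le_coe, coe_nnnorm,
      NNReal.coe_one]
  obtain ⟨F, rfl⟩ : f ∈ Set.range (map A.subtype) := by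
    rw [mem_range_map_iff_coeffs_subset]
    intro x hx
    obtain ⟨m, -, rfl⟩ := mem_coeffs_iff.mp hx
    exact ⟨⟨_, (memA _).mpr (hf m)⟩, rfl⟩
  obtain ⟨b, rfl⟩ : ∃ b : σ → A, a = A.subtype ∘ b :=
    ⟨fun i => ⟨a i, (memA _).mpr (ha i)⟩, rfl⟩
  have eval_map' (c : σ → A) (p : MvPolynomial σ A) :
      eval (A.subtype ∘ c) (map A.subtype p) = (eval c p : A) := by
    rw [eval_map, ← eval₂_comp]; rfl
  have hn (x : A) : ‖(x : K)‖ ≤ 1 := (memA _).mp x.2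
  rw [pderiv_map, eval_map']
  refine ⟨hn _, fun r s t hr hs ht => ?_⟩
  have lift (x : K) (hx : ‖x - (A.subtype ∘ b) i‖ ≤ r) : x ∈ A := by
    simpa using A.add_mem ((memA _).mpr (hx.trans hr)) (b i).2
  lift s to A using lift s hs
  lift t to A using lift t ht
  have up (x : A) : Function.update (A.subtype ∘ b) i (x : K) =
      A.subtype ∘ Function.update b i x := (Function.comp_update A.subtype b i x).symm
  obtain ⟨u, v, h⟩ := F.exists_eval_update_sub_eq b i s t
  rw [up, up, eval_map', eval_map']
  have h' := congrArg (A.subtype) h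
  simp only [map_sub, map_mul, map_add, Subring.subtype_apply] at h'
  rw [h', show ∀ x y z w : K, x * (y + z + w) - x * y = (z + w) * x by intros; ring, norm_mul]
  refine mul_le_mul_of_nonneg_right ?_ (norm_nonneg _)
  refine (IsUltrametricDist.norm_add_le_max _ _).trans (max_le ?_ ?_) <;> rw [norm_mul]
  · exact (mul_le_of_le_one_left (norm_nonneg _) (hn u)).trans ht
  · exact (mul_le_of_le_one_left (norm_nonneg _) (hn v)).trans hs

/-- **Statement 4 (Multivariable Hensel's Lemma).**  Let `K` be a field complete with respect
to a nonarchimedean (multiplicative) absolute value `‖·‖`, with ring of integers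
`A = {x : ‖x‖ ≤ 1}`.  Let `f` be a polynomial in `n ≥ 1` variables with coefficients in `A`
and let `a ∈ Aⁿ` satisfy `‖f(a)‖ < (max_i ‖∂f/∂Xᵢ(a)‖)²`.  Then there is `α ∈ Aⁿ` with
`f(α) = 0` and `max_i ‖αᵢ − aᵢ‖ < max_i ‖∂f/∂Xᵢ(a)‖`. -/
theorem multivariable_hensel {K : Type*} [NormedField K] [CompleteSpace K]
    (hna : ∀ x y : K, ‖x + y‖ ≤ max ‖x‖ ‖y‖)
    {n : ℕ} (hn : 0 < n)
    (f : MvPolynomial (Fin n) K) (hf : ∀ m, ‖f.coeff m‖ ≤ 1)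
    (a : Fin n → K) (ha : ∀ i, ‖a i‖ ≤ 1)
    (h : ‖eval a f‖ <
      (Finset.univ.sup' (Finset.univ_nonempty_iff.mpr ⟨⟨0, hn⟩⟩)
        (fun i => ‖eval a (pderiv i f)‖)) ^ 2) :
    ∃ α : Fin n → K, (∀ i, ‖α i‖ ≤ 1) ∧ eval α f = 0 ∧
      (Finset.univ.sup' (Finset.univ_nonempty_iff.mpr ⟨⟨0, hn⟩⟩)
          (fun i => ‖α i - a i‖)) <
        Finset.univ.sup' (Finset.univ_nonempty_iff.mpr ⟨⟨0, hn⟩⟩)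
          (fun i => ‖eval a (pderiv i f)‖) := by
  have := IsUltrametricDist.isUltrametricDist_of_forall_norm_add_le_max_norm hna
  have hne : (Finset.univ : Finset (Fin n)).Nonempty :=
    Finset.univ_nonempty_iff.mpr ⟨⟨0, hn⟩⟩
  obtain ⟨i, -, hi⟩ := Finset.exists_mem_eq_sup' hne (fun i => ‖eval a (pderiv i f)‖)
  rw [hi] at h ⊢
  obtain ⟨hd1, key⟩ := f.norm_eval_update_sub_le hf a ha i
  set d := eval a (pderiv i f) with hd
  have hd0 : 0 < ‖d‖ := by
    by_contra! h0
    have h0 : ‖d‖ = 0 := le_antisymm h0 (norm_nonneg _)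
    rw [h0] at h
    exact absurd h (by simp)
  have hdne : d ≠ 0 := norm_pos_iff.mp hd0
  set r : ℝ := ‖eval a f‖ / ‖d‖ with hr
  have hr0 : 0 ≤ r := by positivity
  have hrd : r < ‖d‖ := by rw [hr, div_lt_iff₀ hd0]; nlinarith
  have hr1 : r ≤ 1 := hrd.le.trans hd1
  let G : K → K := fun t => eval (Function.update a i t) f
  let φ : K → K := fun t => t - G t / d
  have hφ (s t : K) (hs : ‖s - a i‖ ≤ r) (ht : ‖t - a i‖ ≤ r) :
      ‖φ t - φ s‖ ≤ r / ‖d‖ * ‖t - s‖ := by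
    have e : φ t - φ s = -(G t - G s - (t - s) * d) / d := by
      simp only [φ]; field_simp; ring
    rw [e, norm_div, norm_neg, div_mul_eq_mul_div]
    exact div_le_div_of_nonneg_right (key r s t hr1 hs ht) hd0.le
  have hself : ‖a i - a i‖ ≤ r := by simpa using hr0
  have hmaps : Set.MapsTo φ (Metric.closedBall (a i) r) (Metric.closedBall (a i) r) := by
    intro t ht
    rw [mem_closedBall_iff_norm] at ht ⊢
    have hq : r / ‖d‖ ≤ 1 := (div_le_one hd0).mpr hrd.le
    have h1 : ‖φ t - φ (a i)‖ ≤ r :=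
      (hφ _ _ hself ht).trans ((mul_le_of_le_one_left (norm_nonneg _) hq).trans ht)
    have h2 : ‖φ (a i) - a i‖ ≤ r := by simp [φ, G, hr]
    rw [← sub_add_sub_cancel (φ t) (φ (a i)) (a i)]
    exact (hna _ _).trans (max_le h1 h2)
  have hcontr : ContractingWith (Real.toNNReal (r / ‖d‖)) (hmaps.restrict φ _ _) := by
    refine ⟨Real.toNNReal_lt_one.mpr ((div_lt_one hd0).mpr hrd), LipschitzWith.of_dist_le_mul ?_⟩
    rintro ⟨t, ht⟩ ⟨s, hs⟩
    rw [mem_closedBall_iff_norm] at ht hs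
    rw [Real.coe_toNNReal _ (by positivity), Subtype.dist_eq, Subtype.dist_eq, dist_eq_norm,
      dist_eq_norm]
    exact hφ s t hs ht
  obtain ⟨y, hy, hfix, -⟩ := hcontr.exists_fixedPoint' Metric.isClosed_closedBall.isComplete hmaps
    (Metric.mem_closedBall_self hr0) (edist_ne_top _ _)
  rw [mem_closedBall_iff_norm] at hy
  refine ⟨Function.update a i y, fun j => ?_, ?_, ?_⟩
  · by_cases hj : j = i
    · subst hj
      rw [Function.update_self, ← sub_add_cancel y (a j)]
      exact (hna _ _).trans (max_le (hy.trans hr1) (ha j))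
    · rw [Function.update_of_ne hj]
      exact ha j
  · have h0 : G y / d = 0 := sub_eq_self.mp hfix
    simpa [hdne] using h0
  · refine (Finset.sup'_lt_iff _).mpr fun j _ => ?_
    by_cases hj : j = i
    · subst hj
      rw [Function.update_self]
      exact hy.trans_lt hrd
    · rwa [Function.update_of_ne hj, sub_self, norm_zero]
end

section
/- Let b ∈ ℤ[i] be fourth-power-free, let d ∈ ℤ[i] be a square-free divisor of b, and let p be a primary prime of ℤ[i] with v_p(b) ∈ {1, 3} and p ∤ d. Then C_d(ℚ(i)_p) ≠ ∅ if and only if d^{(Nm(p)−1)/2} ≡ 1 (mod p). -/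
open IsDedekindDomain

noncomputable section

/-- A Gaussian integer is *primary* if it is `≡ 1 (mod (1+i)³)`. -/
def IsPrimary (α : GaussianInt) : Prop := tt ^ 3 ∣ (α - 1)

/-- A Gaussian integer `b` is *fourth-power-free* if no fourth power of a prime divides it. -/
def FourthPowerFree (b : GaussianInt) : Prop := ∀ p : GaussianInt, Prime p → ¬ p ^ 4 ∣ b

/-- `HasLocalPoint b d π` says that the homogeneous space `C_d : d·w² = d² − 4·b·z⁴` has a
point in the completion `ℚ(i)_π` of `ℚ(i)` at the prime `π`, i.e. either the affine equation
`d·w² = d² − 4·b·z⁴` has a solution there, or `b/d` is a square there (the two points at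
infinity are rational).  This is the meaning of `C_d(ℚ(i)_π) ≠ ∅`. -/
def HasLocalPoint (b d π : GaussianInt) : Prop :=
  ∀ v : HeightOneSpectrum GaussianInt, v.asIdeal = Ideal.span {π} →
    (∃ z w : v.adicCompletion (FractionRing GaussianInt),
        algebraMap GaussianInt _ d * w ^ 2
          = (algebraMap GaussianInt _ d) ^ 2 - 4 * algebraMap GaussianInt _ b * z ^ 4)
    ∨ (∃ u : v.adicCompletion (FractionRing GaussianInt),
        u ^ 2 * algebraMap GaussianInt _ d = algebraMap GaussianInt _ b)

section AdicCompletion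

variable {R : Type*} [CommRing R]

/-- Newton's step: a square root of `d` modulo `p ^ (n + 1)` lifts to one modulo `p ^ (n + 2)`. -/
lemma exists_lift_sq_sub_dvd {p a d : R} {n : ℕ} (hcop : IsCoprime (2 * a) p)
    (h : p ^ (n + 1) ∣ a ^ 2 - d) :
    ∃ a', p ^ (n + 1) ∣ a' - a ∧ p ^ (n + 2) ∣ a' ^ 2 - d := by
  obtain ⟨q, hq⟩ := h
  obtain ⟨u, w, huw⟩ := hcop
  refine ⟨a - p ^ (n + 1) * (q * u), ⟨-(q * u), by ring⟩, q * w + p ^ n * (q * u) ^ 2, ?_⟩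
  linear_combination hq - p ^ (n + 1) * q * huw

/-- A square root of `d` modulo `p` lifts to a `p`-adically Cauchy sequence of approximate square
roots of `d`. -/
lemma exists_seq_sq_sub_dvd {p a d : R} (hcop : ∀ x, p ∣ x ^ 2 - d → IsCoprime (2 * x) p)
    (h : p ∣ a ^ 2 - d) :
    ∃ s : ℕ → R, ∀ n, p ^ n ∣ s (n + 1) - s n ∧ p ^ n ∣ s n ^ 2 - d := by
  have step (n : ℕ) (x : {x : R // p ^ (n + 1) ∣ x ^ 2 - d}) :
      ∃ y : {y : R // p ^ (n + 2) ∣ y ^ 2 - d}, p ^ (n + 1) ∣ y.1 - x.1 := by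
    obtain ⟨y, hy, hy'⟩ :=
      exists_lift_sq_sub_dvd (hcop x.1 ((Dvd.intro_left _ (pow_succ p n).symm).trans x.2)) x.2
    exact ⟨⟨y, hy'⟩, hy⟩
  choose f hf using step
  let s (n : ℕ) : {x : R // p ^ (n + 1) ∣ x ^ 2 - d} :=
    Nat.rec (motive := fun n ↦ {x : R // p ^ (n + 1) ∣ x ^ 2 - d}) ⟨a, by simpa using h⟩ f n
  have hs (n : ℕ) : p ^ n ∣ p ^ (n + 1) := pow_dvd_pow p n.le_succ
  exact ⟨fun n ↦ (s n).1, fun n ↦ ⟨(hs n).trans (hf n (s n)), (hs n).trans (s n).2⟩⟩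

variable [IsDedekindDomain R] {K : Type*} [Field K] [Algebra R K] [IsFractionRing R K]
  {v : HeightOneSpectrum R} {p : R}

lemma valued_algebraMap (r : R) :
    Valued.v (algebraMap R (v.adicCompletion K) r) = v.intValuation r := by
  rw [← v.valuation_of_algebraMap (K := K)]
  exact v.valuedAdicCompletion_eq_valuation r

lemma intValuation_lt_one_iff_dvd_generator (hv : v.asIdeal = Ideal.span {p}) (r : R) :
    v.intValuation r < 1 ↔ p ∣ r := by
  rw [v.intValuation_lt_one_iff_mem, hv, Ideal.mem_span_singleton]

lemma intValuation_eq_one_iff_not_dvd_generator (hv : v.asIdeal = Ideal.span {p}) (r : R) :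
    v.intValuation r = 1 ↔ ¬ p ∣ r := by
  rw [HeightOneSpectrum.intValuation_eq_one_iff, hv, Ideal.mem_span_singleton]

lemma intValuation_eq_exp_neg (hv : v.asIdeal = Ideal.span {p}) (hp : p ≠ 0) {b : R} {k : ℕ}
    (h : p ^ k ∣ b) (h' : ¬ p ^ (k + 1) ∣ b) : v.intValuation b = WithZero.exp (-(k : ℤ)) := by
  obtain ⟨c, rfl⟩ := h
  have hc : ¬ p ∣ c := fun hc ↦ h' (by rw [pow_succ]; exact mul_dvd_mul_left _ hc)
  rw [map_mul, map_pow, v.intValuation_singleton hp hv,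
    (intValuation_eq_one_iff_not_dvd_generator hv c).2 hc, mul_one, ← WithZero.exp_nsmul]
  simp

lemma tendsto_algebraMap_zero_of_pow_dvd (hv : v.asIdeal = Ideal.span {p}) {s : ℕ → R}
    (hs : ∀ n, p ^ n ∣ s n) :
    Filter.Tendsto (fun n ↦ algebraMap R (v.adicCompletion K) (s n)) Filter.atTop (nhds 0) := by
  have hp : Valued.v (algebraMap R (v.adicCompletion K) p) < 1 := by
    rw [valued_algebraMap, intValuation_lt_one_iff_dvd_generator hv]
  have key := Valued.tendsto_zero_pow_of_v_lt_one hp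
  rw [(Valued.hasBasis_nhds_zero _ _).tendsto_right_iff] at key ⊢
  intro γ hγ
  filter_upwards [key γ hγ] with n hn
  refine lt_of_le_of_lt ?_ hn
  obtain ⟨c, hc⟩ := hs n
  rw [Valuation.restrict_le_iff, hc, map_mul, map_mul, map_pow]
  refine mul_le_of_le_one_right' ?_
  rw [valued_algebraMap]
  exact v.intValuation_le_one c

lemma Valued.nonarchimedeanAddGroup {L Γ : Type*} [Ring L] [LinearOrderedCommGroupWithZero Γ]
    [Valued L Γ] : NonarchimedeanAddGroup L where
  is_nonarchimedean U hU := by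
    obtain ⟨γ, hγ⟩ := Valued.mem_nhds_zero.1 hU
    exact ⟨⟨Valued.v.restrict.ltAddSubgroup γ, Valued.isOpen_ball L γ.1⟩, hγ⟩

lemma exists_sq_eq_of_tendsto {L Γ : Type*} [CommRing L] [LinearOrderedCommGroupWithZero Γ]
    [Valued L Γ] [CompleteSpace L] [T2Space L] {s : ℕ → L} {d : L}
    (h₁ : Filter.Tendsto (fun n ↦ s (n + 1) - s n) Filter.atTop (nhds 0))
    (h₂ : Filter.Tendsto (fun n ↦ s n ^ 2 - d) Filter.atTop (nhds 0)) :
    ∃ w : L, w ^ 2 = d := by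
  have : NonarchimedeanAddGroup L := Valued.nonarchimedeanAddGroup
  obtain ⟨w, hw⟩ := cauchySeq_tendsto_of_complete
    (NonarchimedeanAddGroup.cauchySeq_of_tendsto_sub_nhds_zero h₁)
  exact ⟨w, sub_eq_zero.1 (tendsto_nhds_unique ((hw.pow 2).sub_const d) h₂)⟩

lemma exists_sq_eq_algebraMap (hv : v.asIdeal = Ideal.span {p}) {a d : R}
    (hcop : ∀ x, p ∣ x ^ 2 - d → IsCoprime (2 * x) p) (h : p ∣ a ^ 2 - d) :
    ∃ w : v.adicCompletion K, w ^ 2 = algebraMap R _ d := by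
  obtain ⟨s, hs⟩ := exists_seq_sq_sub_dvd hcop h
  have h₁ := tendsto_algebraMap_zero_of_pow_dvd (K := K) hv fun n ↦ (hs n).1
  have h₂ := tendsto_algebraMap_zero_of_pow_dvd (K := K) hv fun n ↦ (hs n).2
  refine exists_sq_eq_of_tendsto (s := fun n ↦ algebraMap R (v.adicCompletion K) (s n)) ?_ ?_
  · simpa only [map_sub] using h₁
  · simpa only [map_sub, map_pow] using h₂

lemma exists_valued_algebraMap_sub_lt_one {w : v.adicCompletion K} (hw : Valued.v w ≤ 1) :
    ∃ r : R, Valued.v (algebraMap R (v.adicCompletion K) r - w) < 1 := by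
  obtain ⟨k, hk⟩ : ∃ k : K, Valued.v (algebraMap K (v.adicCompletion K) k - w) < 1 := by
    have hopen : {x : v.adicCompletion K | Valued.v (x - w) < 1} ∈ nhds w := by
      rw [Valued.mem_nhds]
      exact ⟨1, fun y hy ↦ by simpa using hy⟩
    obtain ⟨x, ⟨k, rfl⟩, hx⟩ :=
      ((HeightOneSpectrum.denseRange_algebraMap (R := R) (K := K) (v := v)).inter_nhds_nonempty hopen)
    exact ⟨k, hx⟩
  have hk' : v.valuation K k ≤ 1 := by
    rw [← v.valuedAdicCompletion_eq_valuation' k]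
    have := Valuation.map_add_le _ hk.le hw
    rwa [sub_add_cancel] at this
  obtain ⟨r, hr⟩ := v.exists_valuation_sub_lt_of_integer hk' 1
  refine ⟨r, ?_⟩
  rw [← v.valuedAdicCompletion_eq_valuation'] at hr
  have hr' : Valued.v (algebraMap R (v.adicCompletion K) r - algebraMap K _ k) < 1 := by
    rw [IsScalarTower.algebraMap_apply R K, ← map_sub]
    exact hr
  simpa using Valuation.map_add_lt _ hr' hk

lemma dvd_sq_sub_of_valued_sq_sub_lt_one (hv : v.asIdeal = Ideal.span {p}) {d : R}
    {w : v.adicCompletion K} (h : Valued.v (w ^ 2 - algebraMap R _ d) < 1) :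
    ∃ a, p ∣ a ^ 2 - d := by
  have hd : Valued.v (algebraMap R (v.adicCompletion K) d) ≤ 1 := by
    rw [valued_algebraMap]; exact v.intValuation_le_one d
  have hw : Valued.v w ≤ 1 := by
    have := Valuation.map_add_le _ h.le hd
    rw [sub_add_cancel, map_pow] at this
    exact (pow_le_one_iff two_ne_zero).1 this
  obtain ⟨a, ha⟩ := exists_valued_algebraMap_sub_lt_one hw
  refine ⟨a, ?_⟩
  have ha' : Valued.v (algebraMap R (v.adicCompletion K) a + w) ≤ 1 := by
    refine Valuation.map_add_le _ ?_ hw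
    rw [valued_algebraMap]; exact v.intValuation_le_one a
  rw [← intValuation_lt_one_iff_dvd_generator hv, ← valued_algebraMap (K := K)]
  have hmul : Valued.v ((algebraMap R (v.adicCompletion K) a - w) * (algebraMap R _ a + w)) < 1 := by
    rw [map_mul]
    exact mul_lt_one_of_lt_of_le ha ha'
  refine lt_of_eq_of_lt (congrArg _ ?_) (Valuation.map_add_lt _ hmul h)
  simp only [map_sub, map_pow]
  ring

lemma dvd_sq_sub_of_local_point (hv : v.asIdeal = Ideal.span {p}) {b c d : R} {k : ℤ} (hk : Odd k)
    (hb : v.intValuation b = WithZero.exp k) (hc : v.intValuation c = 1)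
    (hd : v.intValuation d = 1) {z w : v.adicCompletion K}
    (h : algebraMap R _ d * w ^ 2
      = (algebraMap R _ d) ^ 2 - algebraMap R _ c * algebraMap R _ b * z ^ 4) :
    ∃ a, p ∣ a ^ 2 - d := by
  rw [← valued_algebraMap (K := K)] at hb hc hd
  set D := algebraMap R (v.adicCompletion K) d
  set X := algebraMap R (v.adicCompletion K) c * algebraMap R _ b * z ^ 4 with hX
  have hD2 : Valued.v (D ^ 2) = 1 := by rw [map_pow, hd, one_pow]
  have hXlt : Valued.v X < 1 := by
    by_contra! hge
    have hz : z ≠ 0 := by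
      rintro rfl
      simp [hX] at hge
    have hn := (WithZero.exp_log ((Valuation.ne_zero_iff Valued.v).2 hz)).symm
    set n := WithZero.log (Valued.v z)
    have hXv : Valued.v X = WithZero.exp (k + 4 * n) := by
      rw [hX, map_mul, map_mul, hb, hc, map_pow, hn, one_mul, ← WithZero.exp_nsmul,
        ← WithZero.exp_add]
      simp
    have hgt : Valued.v (D ^ 2) < Valued.v X := by
      rw [hXv, ← WithZero.exp_zero, WithZero.exp_le_exp] at hge
      rw [hD2, hXv, ← WithZero.exp_zero, WithZero.exp_lt_exp]
      obtain ⟨j, rfl⟩ := hk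
      omega
    have hw : Valued.v w ^ 2 = WithZero.exp (k + 4 * n) := by
      rw [← hXv, ← Valuation.map_sub_eq_of_lt_right _ hgt, ← h, map_mul, hd, one_mul, map_pow]
    have hw0 : Valued.v w ≠ 0 := by
      intro h0
      rw [h0, zero_pow two_ne_zero] at hw
      exact WithZero.exp_ne_zero hw.symm
    rw [← WithZero.exp_log hw0, ← WithZero.exp_nsmul, WithZero.exp_inj] at hw
    obtain ⟨j, rfl⟩ := hk
    simp at hw
    omega
  refine dvd_sq_sub_of_valued_sq_sub_lt_one (K := K) (w := w) hv ?_
  have : D * (w ^ 2 - D) = -X := by linear_combination h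
  have := congrArg Valued.v this
  rw [map_mul, hd, one_mul, Valuation.map_neg] at this
  exact this.trans_lt hXlt

lemma false_of_sq_mul_eq {b d : R} {k : ℤ} (hk : Odd k)
    (hb : v.intValuation b = WithZero.exp k) (hd : v.intValuation d = 1)
    {u : v.adicCompletion K} (h : u ^ 2 * algebraMap R _ d = algebraMap R _ b) : False := by
  rw [← valued_algebraMap (K := K)] at hb hd
  rw [← h, map_mul, hd, mul_one, map_pow] at hb
  have hu0 : Valued.v u ≠ 0 := by
    intro h0
    rw [h0, zero_pow two_ne_zero] at hb
    exact WithZero.exp_ne_zero hb.symm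
  rw [← WithZero.exp_log hu0, ← WithZero.exp_nsmul, WithZero.exp_inj] at hb
  obtain ⟨j, rfl⟩ := hk
  simp at hb
  omega

end AdicCompletion

section GaussianInt

/-- The basis `1, i` of `ℤ[i]` over `ℤ`. -/
def gaussianIntBasis : Module.Basis (Fin 2) ℤ GaussianInt :=
  .ofEquivFun
    { toFun := fun x ↦ ![x.re, x.im]
      invFun := fun f ↦ ⟨f 0, f 1⟩
      left_inv := fun x ↦ rfl
      right_inv := fun f ↦ by ext j; fin_cases j <;> rfl
      map_add' := fun x y ↦ by ext j; fin_cases j <;> rfl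
      map_smul' := fun n x ↦ by ext j; fin_cases j <;> simp }

lemma gaussianInt_algebraNorm (x : GaussianInt) : Algebra.norm ℤ x = x.norm := by
  rw [Algebra.norm_eq_matrix_det gaussianIntBasis, Matrix.det_fin_two]
  have hr (y : GaussianInt) : gaussianIntBasis.repr y 0 = y.re ∧ gaussianIntBasis.repr y 1 = y.im :=
    ⟨rfl, rfl⟩
  have h₀ : gaussianIntBasis 0 = 1 := by
    rw [Module.Basis.apply_eq_iff]
    ext j
    fin_cases j
    · exact (hr 1).1.trans (by simp)
    · exact (hr 1).2.trans (by simp)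
  have h₁ : gaussianIntBasis 1 = ii := by
    rw [Module.Basis.apply_eq_iff]
    ext j
    fin_cases j
    · exact (hr ii).1.trans (by simp [ii])
    · exact (hr ii).2.trans (by simp [ii])
  simp [Algebra.leftMulMatrix_eq_repr_mul, h₀, h₁, hr, ii, Zsqrtd.norm_def]

lemma card_quotient_span_singleton (p : GaussianInt) :
    Nat.card (GaussianInt ⧸ Ideal.span {p}) = p.norm.natAbs := by
  have : Module.Free ℤ GaussianInt := .of_basis gaussianIntBasis
  have : Module.Finite ℤ GaussianInt := .of_basis gaussianIntBasis
  rw [← gaussianInt_algebraNorm, ← Ideal.absNorm_span_singleton, Ideal.absNorm_apply,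
    Submodule.cardQuot_apply]

lemma IsPrimary.odd_norm {p : GaussianInt} (h : IsPrimary p) : Odd p.norm.natAbs := by
  obtain ⟨c, hc⟩ := h
  have h3 : tt ^ 3 = ⟨-2, 2⟩ := by decide
  rw [h3] at hc
  have hre := congrArg Zsqrtd.re hc
  have him := congrArg Zsqrtd.im hc
  simp at hre him
  rw [Int.natAbs_odd, Zsqrtd.norm_def]
  have h1 : Odd p.re := ⟨-c.re - c.im, by linarith⟩
  have h2 : Even p.im := ⟨c.re - c.im, by linarith⟩
  simpa using (h1.mul h1).add_even (h2.mul_right p.im)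

/-- Euler's criterion in `ℤ[i]`. -/
lemma exists_dvd_sq_sub_iff {p d : GaussianInt} (hp : Prime p) (hodd : Odd p.norm.natAbs)
    (hpd : ¬ p ∣ d) :
    (∃ a, p ∣ a ^ 2 - d) ↔ p ∣ d ^ ((p.norm.natAbs - 1) / 2) - 1 := by
  have : (Ideal.span {p}).IsMaximal :=
    PrincipalIdealRing.isMaximal_of_irreducible hp.irreducible
  let : Field (GaussianInt ⧸ Ideal.span {p}) := Ideal.Quotient.field _
  have hcard := card_quotient_span_singleton p
  have : Finite (GaussianInt ⧸ Ideal.span {p}) := by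
    refine Nat.finite_of_card_ne_zero ?_
    rw [hcard]
    exact hodd.pos.ne'
  let := Fintype.ofFinite (GaussianInt ⧸ Ideal.span {p})
  rw [Nat.card_eq_fintype_card] at hcard
  have hmk (x y : GaussianInt) : p ∣ x - y ↔
      Ideal.Quotient.mk (Ideal.span {p}) x = Ideal.Quotient.mk (Ideal.span {p}) y := by
    rw [Ideal.Quotient.eq, Ideal.mem_span_singleton]
  have hd : Ideal.Quotient.mk (Ideal.span {p}) d ≠ 0 := by
    rwa [Ne, Ideal.Quotient.eq_zero_iff_dvd]
  have hchar : ringChar (GaussianInt ⧸ Ideal.span {p}) ≠ 2 := by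
    rw [Ne, FiniteField.even_card_iff_char_two, hcard, ← Nat.even_iff, Nat.not_even_iff_odd]
    exact hodd
  have hhalf : (p.norm.natAbs - 1) / 2 = p.norm.natAbs / 2 := by
    obtain ⟨m, hm⟩ := hodd
    omega
  rw [hmk, hhalf, map_pow, map_one, ← hcard, ← FiniteField.isSquare_iff hchar hd]
  constructor
  · rintro ⟨a, ha⟩
    rw [hmk, map_pow] at ha
    exact ⟨_, by rw [← ha, sq]⟩
  · rintro ⟨a, ha⟩
    obtain ⟨a, rfl⟩ := Ideal.Quotient.mk_surjective a
    exact ⟨a, by rw [hmk, map_pow, ha, sq]⟩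

lemma not_dvd_two_of_odd_norm {p : GaussianInt} (hp : Prime p) (hodd : Odd p.norm.natAbs) :
    ¬ p ∣ 2 := by
  rintro ⟨c, hc⟩
  have h := congrArg Zsqrtd.norm hc
  rw [Zsqrtd.norm_mul] at h
  have h4 : p.norm.natAbs ∣ 2 ^ 2 := by
    refine ⟨c.norm.natAbs, ?_⟩
    rw [← Int.natAbs_mul, ← h]
    decide
  have h1 := Nat.Coprime.eq_one_of_dvd ((Nat.coprime_two_right.2 hodd).pow_right 2) h4
  exact hp.not_isUnit (Zsqrtd.norm_eq_one_iff.1 h1)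

end GaussianInt

/-- **Statement 5.**  Let `b ∈ ℤ[i]` be fourth-power-free, `d` a square-free divisor of `b`,
and `p` a primary prime with `v_p(b) ∈ {1,3}` and `p ∤ d`.  Then `C_d(ℚ(i)_p) ≠ ∅` iff
`d^{(Nm(p)−1)/2} ≡ 1 (mod p)`. -/
theorem local_solubility_case1 (b d p : GaussianInt)
    (hb4 : FourthPowerFree b) (hd : Squarefree d) (hdvd : d ∣ b)
    (hp : Prime p) (hprim : IsPrimary p)
    (hvp : (p ∣ b ∧ ¬ p ^ 2 ∣ b) ∨ (p ^ 3 ∣ b ∧ ¬ p ^ 4 ∣ b))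
    (hpd : ¬ p ∣ d) :
    HasLocalPoint b d p ↔ p ∣ (d ^ ((p.norm.natAbs - 1) / 2) - 1) := by
  have hodd := hprim.odd_norm
  have hp2 := not_dvd_two_of_odd_norm hp hodd
  rw [← exists_dvd_sq_sub_iff hp hodd hpd]
  constructor
  · intro h
    let v : HeightOneSpectrum GaussianInt :=
      ⟨Ideal.span {p}, (Ideal.span_singleton_prime hp.ne_zero).2 hp, by
        simpa using hp.ne_zero⟩
    have hv : v.asIdeal = Ideal.span {p} := rfl
    obtain ⟨k, hk, hbk⟩ : ∃ k : ℤ, Odd k ∧ v.intValuation b = WithZero.exp k := by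
      rcases hvp with ⟨h₁, h₂⟩ | ⟨h₁, h₂⟩
      · exact ⟨_, by decide, intValuation_eq_exp_neg hv hp.ne_zero (k := 1) (by simpa) h₂⟩
      · exact ⟨_, by decide, intValuation_eq_exp_neg hv hp.ne_zero (k := 3) h₁ h₂⟩
    have hdv := (intValuation_eq_one_iff_not_dvd_generator hv d).2 hpd
    have hp4 : ¬ p ∣ 4 := by
      rw [show (4 : GaussianInt) = 2 ^ 2 by norm_num]
      exact fun h4 ↦ hp2 (hp.dvd_of_dvd_pow h4)
    rcases h v hv with ⟨z, w, hzw⟩ | ⟨u, hu⟩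
    · refine dvd_sq_sub_of_local_point hv hk hbk
        ((intValuation_eq_one_iff_not_dvd_generator hv 4).2 hp4) hdv (z := z) (w := w) ?_
      rwa [map_ofNat]
    · exact (false_of_sq_mul_eq hk hbk hdv hu).elim
  · rintro ⟨a, ha⟩ v hv
    have hcop (x : GaussianInt) (hx : p ∣ x ^ 2 - d) : IsCoprime (2 * x) p := by
      refine (hp.irreducible.coprime_iff_not_dvd.2 fun h ↦ ?_).symm
      rcases hp.dvd_or_dvd h with h | h
      · exact hp2 h
      · exact hpd ((dvd_sub_right (h.trans (dvd_pow_self x two_ne_zero))).1 hx)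
    obtain ⟨w, hw⟩ := exists_sq_eq_algebraMap (K := FractionRing GaussianInt) hv hcop ha
    exact .inl ⟨0, w, by rw [hw]; ring⟩
end
end

section
/- Let b ∈ ℤ[i] be nonzero and fourth-power-free, and let d ∈ ℤ[i] be a square-free divisor of b. Set t_b := v_{(1+i)}(b), t_d := v_{(1+i)}(d), b₀ := b/(1+i)^{t_b}, d₀ := d/(1+i)^{t_d}. Then C_d(ℚ(i)_{(1+i)}) ≠ ∅ if and only if at least one of the following holds: (A) t_b ≡ t_d (mod 2) and there exist k ∈ {0,1,2} and ε ∈ {1,−1} with b₀ ≡ d₀(ε − d₀·(1+i)^{4k+t_b}) (mod (1+i)⁵); (B) t_d = 0 and there exist k ∈ {0,1,2} and ε ∈ {1,−1} with b·(1+i)^{4k} ≡ d₀(ε − d₀) (mod (1+i)⁵); (C) t_b = 2·t_d and there exist k ∈ {1,2,3,4} and an odd α₀ ∈ ℤ[i] with b₀ ≡ −d₀(d₀ − α₀²·(1+i)^{2k−t_d}) (mod (1+i)⁷). -/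
open IsDedekindDomain

noncomputable section

/-- The properties of the ring of integers `O` of the completion `K` of `ℚ(i)` at `1 + i` from
which solubility of the quartic `C_d` can be decided. -/
structure IsIntegersAtOneAddI (O K : Type*) [CommRing O] [Field K] [Algebra GaussianInt O]
    [Algebra O K] : Prop where
  injective : Function.Injective (algebraMap O K)
  map_ne_zero : algebraMap GaussianInt O tt ≠ 0
  dvd_of_dvd_map (a : GaussianInt) :
    algebraMap GaussianInt O tt ∣ algebraMap GaussianInt O a → tt ∣ a
  dvd_or_dvd_sub_one (x : O) :
    algebraMap GaussianInt O tt ∣ x ∨ algebraMap GaussianInt O tt ∣ x - 1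
  isUnit_of_not_dvd (x : O) : ¬ algebraMap GaussianInt O tt ∣ x → IsUnit x
  exists_eq_add_mul_sq (a c : O) : ∃ z : O, z = c + algebraMap GaussianInt O tt * a * z ^ 2
  exists_eq_zpow_mul (x : K) : x ≠ 0 → ∃ (n : ℤ) (u : O), IsUnit u ∧
    x = algebraMap O K (algebraMap GaussianInt O tt) ^ n * algebraMap O K u

lemma ii_sq : ii ^ 2 = -1 := by simp only [ii]; decide

lemma two_eq : (2 : GaussianInt) = -ii * tt ^ 2 := by simp only [tt, ii]; decide

lemma not_tt_dvd_one : ¬ tt ∣ 1 := by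
  rintro ⟨c, hc⟩
  have h := congrArg Zsqrtd.norm hc
  rw [Zsqrtd.norm_mul] at h
  have : Zsqrtd.norm tt = 2 := by decide
  rw [this] at h
  simp at h
  omega

lemma tt_dvd_or_dvd_sub_one (a : GaussianInt) : tt ∣ a ∨ tt ∣ a - 1 := by
  obtain ⟨p, q⟩ := a
  rcases Int.even_or_odd' (p + q) with ⟨c, hc | hc⟩
  · refine .inl ⟨⟨c, c - p⟩, ?_⟩
    ext
    · simp [tt, ii]
    · simp [tt, ii]
      omega
  · refine .inr ⟨⟨c, c + 1 - p⟩, ?_⟩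
    ext <;> simp [tt, ii] <;> omega

lemma tt_ne_zero : tt ≠ 0 := by simp only [tt, ii]; decide

lemma prime_tt : Prime tt := by
  refine ⟨tt_ne_zero, fun h => not_tt_dvd_one h.dvd, fun a b hab => ?_⟩
  by_contra! h
  have ha := (tt_dvd_or_dvd_sub_one a).resolve_left h.1
  have hb := (tt_dvd_or_dvd_sub_one b).resolve_left h.2
  apply not_tt_dvd_one
  have : (1 : GaussianInt) = a * b - (a - 1) * b - (b - 1) := by ring
  rw [this]
  exact dvd_sub (dvd_sub hab (ha.mul_right b)) hb

/-- Squares of odd elements are congruent to `±1` modulo `(1 + i)⁵`. -/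
lemma exists_sign_pow_five_dvd_sq_sub {R : Type*} [CommRing R] {I π s : R} (hI : I ^ 2 = -1)
    (hπ : π = 1 + I) (h : ∀ x : R, π ∣ x ∨ π ∣ x - 1) (hs : ¬ π ∣ s) :
    ∃ ε : ℤ, (ε = 1 ∨ ε = -1) ∧ π ^ 5 ∣ s ^ 2 - ε := by
  have hcons (y : R) : π ∣ y * (y - I) := by
    rcases h y with hy | hy
    · exact hy.mul_right _
    · refine Dvd.dvd.mul_left ?_ _
      have : y - I = y - 1 - π * I := by rw [hπ]; linear_combination hI
      rw [this]
      exact dvd_sub hy (dvd_mul_right _ _)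
  obtain ⟨x, hx⟩ := (h s).resolve_left hs
  obtain rfl : s = 1 + π * x := by linear_combination hx
  rcases h x with ⟨y, rfl⟩ | ⟨y, hy⟩
  · obtain ⟨c, hc⟩ := hcons y
    refine ⟨1, .inl rfl, c, ?_⟩
    subst hπ
    push_cast
    linear_combination (1 + I) ^ 4 * hc + (1 + I) ^ 2 * y * (I + 2) * hI
  · obtain rfl : x = 1 + π * y := by linear_combination hy
    obtain ⟨c, hc⟩ := hcons y
    refine ⟨-1, .inr rfl, c + (-1 - I * y), ?_⟩
    subst hπ
    push_cast
    linear_combination (1 + I) ^ 4 * hc + (6 + 9 * I + 5 * I ^ 2 + I ^ 3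
      + y * (4 + 12 * I + 13 * I ^ 2 + 6 * I ^ 3 + I ^ 4)) * hI

/-- The congruence conditions that characterise solubility of `C_d` at `1 + i`. -/
def SolubilityCongruences (b b₀ d₀ : GaussianInt) (tb td : ℕ) : Prop :=
  (tb % 2 = td % 2 ∧ ∃ k ≤ 2, ∃ ε : GaussianInt, (ε = 1 ∨ ε = -1) ∧
      tt ^ 5 ∣ (b₀ - d₀ * (ε - d₀ * tt ^ (4 * k + tb)))) ∨
    (td = 0 ∧ ∃ k ≤ 2, ∃ ε : GaussianInt, (ε = 1 ∨ ε = -1) ∧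
      tt ^ 5 ∣ (b * tt ^ (4 * k) - d₀ * (ε - d₀))) ∨
    (tb = 2 * td ∧ ∃ k, 1 ≤ k ∧ k ≤ 4 ∧ ∃ α₀ : GaussianInt, ¬ tt ∣ α₀ ∧
      tt ^ 7 ∣ (b₀ - (-(d₀ * (d₀ - α₀ ^ 2 * tt ^ (2 * k - td))))))

namespace IsIntegersAtOneAddI

variable {O K : Type*} [CommRing O] [Field K] [Algebra GaussianInt O] [Algebra O K]

local notation "f" => algebraMap GaussianInt O
local notation "ϖ" => algebraMap GaussianInt O tt

lemma map_ii_sq : f ii ^ 2 = -1 := by rw [← map_pow, ii_sq, map_neg, map_one]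

lemma map_tt : ϖ = 1 + f ii := by rw [tt, map_add, map_one]

lemma two_eq_map : (2 : O) = -f ii * ϖ ^ 2 := by
  rw [← map_neg, ← map_pow, ← map_mul, ← two_eq, map_ofNat]

lemma map_tt_pow_four : ϖ ^ 4 = -4 := by
  linear_combination (2 - f ii * ϖ ^ 2) * two_eq_map (O := O) + ϖ ^ 4 * map_ii_sq (O := O)

lemma not_dvd_of_isUnit (h : IsIntegersAtOneAddI O K) {x : O} (hx : IsUnit x) : ¬ ϖ ∣ x := fun hd =>
  not_tt_dvd_one (h.dvd_of_dvd_map 1 (by rw [map_one]; exact hd.trans hx.dvd))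

lemma isUnit_map (h : IsIntegersAtOneAddI O K) {a : GaussianInt} (ha : ¬ tt ∣ a) : IsUnit (f a) :=
  h.isUnit_of_not_dvd _ fun hd => ha (h.dvd_of_dvd_map a hd)

lemma isUnit_add (h : IsIntegersAtOneAddI O K)
    {x y : O} (hx : IsUnit x) (hy : ϖ ∣ y) : IsUnit (x + y) :=
  h.isUnit_of_not_dvd _ fun hd => h.not_dvd_of_isUnit hx ((dvd_add_left hy).1 hd)

lemma dvd_add_of_isUnit (h : IsIntegersAtOneAddI O K)
    {x y : O} (hx : IsUnit x) (hy : IsUnit y) : ϖ ∣ x + y := by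
  have h1 := (h.dvd_or_dvd_sub_one x).resolve_left (h.not_dvd_of_isUnit hx)
  have h2 := (h.dvd_or_dvd_sub_one y).resolve_left (h.not_dvd_of_isUnit hy)
  have h3 : ϖ ∣ 2 := two_eq_map (O := O) ▸ (dvd_pow_self _ two_ne_zero).mul_left _
  have : x + y = (x - 1) + (y - 1) + 2 := by ring
  rw [this]
  exact dvd_add (dvd_add h1 h2) h3

lemma map_tt_ne_zero (h : IsIntegersAtOneAddI O K) : algebraMap O K ϖ ≠ 0 := by
  exact (map_ne_zero_iff _ h.injective).2 h.map_ne_zero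

lemma isDomain (h : IsIntegersAtOneAddI O K) : IsDomain O := h.injective.isDomain (algebraMap O K)

lemma dvd_of_pow_dvd_map (h : IsIntegersAtOneAddI O K)
    (n : ℕ) (a : GaussianInt) (hd : ϖ ^ n ∣ f a) : tt ^ n ∣ a := by
  have := h.isDomain
  have h0 := h.map_ne_zero
  induction n generalizing a with
  | zero => simp
  | succ n ih =>
    obtain ⟨c, rfl⟩ := h.dvd_of_dvd_map a ((dvd_pow_self _ n.succ_ne_zero).trans hd)
    rw [map_mul, pow_succ', mul_dvd_mul_iff_left h0] at hd
    rw [pow_succ']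
    exact mul_dvd_mul_left _ (ih c hd)

lemma exists_pow_dvd_sub_map (h : IsIntegersAtOneAddI O K)
    (n : ℕ) (x : O) : ∃ a : GaussianInt, ϖ ^ n ∣ x - f a := by
  induction n with
  | zero => exact ⟨0, by simp⟩
  | succ n ih =>
    obtain ⟨a, c, hc⟩ := ih
    rcases h.dvd_or_dvd_sub_one c with ⟨y, hy⟩ | ⟨y, hy⟩
    · exact ⟨a, y, by rw [hc, hy]; ring⟩
    · refine ⟨a + tt ^ n, y, ?_⟩
      rw [map_add, map_pow]
      linear_combination hc + ϖ ^ n * hy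

lemma exists_sq_eq (h : IsIntegersAtOneAddI O K) (c : O) : ∃ y : O, y ^ 2 = 1 + ϖ ^ 5 * c := by
  obtain ⟨z, hz⟩ := h.exists_eq_add_mul_sq (-f ii) (f ii * c)
  refine ⟨1 + ϖ ^ 3 * z, ?_⟩
  linear_combination ϖ ^ 3 * z * two_eq_map (O := O) - f ii * ϖ ^ 5 * hz
    + ϖ ^ 5 * (ϖ * z ^ 2 - c) * map_ii_sq (O := O)

lemma exists_pow_four_eq (h : IsIntegersAtOneAddI O K)
    (c : O) : ∃ y : O, y ^ 4 = 1 + ϖ ^ 7 * c := by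
  obtain ⟨z, hz⟩ := h.exists_eq_add_mul_sq (-f ii * ϖ ^ 2) (f ii * c)
  obtain ⟨y, hy⟩ := h.exists_sq_eq z
  refine ⟨y, ?_⟩
  linear_combination (y ^ 2 + 1 + ϖ ^ 5 * z) * hy + ϖ ^ 5 * z * two_eq_map (O := O)
    - f ii * ϖ ^ 7 * hz + ϖ ^ 7 * (ϖ ^ 3 * z ^ 2 - c) * map_ii_sq (O := O)

lemma exists_sign (h : IsIntegersAtOneAddI O K) {s : O} (hs : IsUnit s) :
    ∃ ε : GaussianInt, (ε = 1 ∨ ε = -1) ∧ ϖ ^ 5 ∣ s ^ 2 - f ε := by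
  obtain ⟨ε, hε, hd⟩ := exists_sign_pow_five_dvd_sq_sub map_ii_sq map_tt h.dvd_or_dvd_sub_one
    (h.not_dvd_of_isUnit hs)
  refine ⟨ε, ?_, by simpa using hd⟩
  rcases hε with rfl | rfl <;> simp

lemma pow_seven_dvd_pow_four_sub_one (h : IsIntegersAtOneAddI O K)
    {u : O} (hu : IsUnit u) : ϖ ^ 7 ∣ u ^ 4 - 1 := by
  obtain ⟨ε, hε, c, hc⟩ := h.exists_sign hu
  have hε2 : f ε ^ 2 = 1 := by rcases hε with rfl | rfl <;> simp
  refine ⟨-f ii * f ε * c + ϖ ^ 3 * c ^ 2, ?_⟩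
  linear_combination (u ^ 2 + f ε + ϖ ^ 5 * c) * hc + hε2
    + ϖ ^ 5 * c * f ε * two_eq_map (O := O)

/-- The congruences in the criterion lift to equations with a square. -/
lemma exists_sq_of_dvd (h : IsIntegersAtOneAddI O K)
    {b₀ d₀ x ε : GaussianInt} (hd₀ : ¬ tt ∣ d₀) (hε : ε = 1 ∨ ε = -1)
    (hdvd : tt ^ 5 ∣ b₀ - d₀ * (ε - x)) : ∃ s : O, f b₀ + f d₀ * f x = f d₀ * s ^ 2 := by
  obtain ⟨c, hc⟩ := hdvd
  obtain ⟨D, hD⟩ := (h.isUnit_map hd₀).exists_right_inv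
  have hc' := congrArg f hc
  simp only [map_sub, map_mul, map_pow] at hc'
  have hε2 : f ε ^ 2 = 1 := by rcases hε with rfl | rfl <;> simp
  obtain ⟨y, hy⟩ := h.exists_sq_eq (f ε * D * f c)
  obtain ⟨j, hj⟩ : ∃ j : O, j ^ 2 = f ε := by
    rcases hε with rfl | rfl
    · exact ⟨1, by simp⟩
    · exact ⟨f ii, by simp [map_ii_sq]⟩
  refine ⟨j * y, ?_⟩
  linear_combination hc' - f d₀ * f ε * hy - f d₀ * y ^ 2 * hj - ϖ ^ 5 * f c * hD
    - f d₀ * ϖ ^ 5 * D * f c * hε2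

lemma exists_sign_dvd (h : IsIntegersAtOneAddI O K) {b₀ d₀ x : GaussianInt} {s : O} (hs : IsUnit s)
    (hdvd : ϖ ^ 5 ∣ f b₀ + f d₀ * f x - f d₀ * s ^ 2) :
    ∃ ε : GaussianInt, (ε = 1 ∨ ε = -1) ∧ tt ^ 5 ∣ b₀ - d₀ * (ε - x) := by
  obtain ⟨ε, hε, hd⟩ := h.exists_sign hs
  refine ⟨ε, hε, h.dvd_of_pow_dvd_map _ _ ?_⟩
  have : f (b₀ - d₀ * (ε - x)) = (f b₀ + f d₀ * f x - f d₀ * s ^ 2) + f d₀ * (s ^ 2 - f ε) := by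
    simp only [map_sub, map_mul]; ring
  rw [this]
  exact dvd_add hdvd (hd.mul_left _)

lemma eq_pow_mul_of_zpow_mul_eq (h : IsIntegersAtOneAddI O K)
    {p q : ℤ} {n : ℕ} {x y : O} (hn : q = p + n)
    (he : algebraMap O K ϖ ^ p * algebraMap O K x = algebraMap O K ϖ ^ q * algebraMap O K y) :
    x = ϖ ^ n * y := by
  apply h.injective
  have h0 := h.map_tt_ne_zero
  rw [hn, zpow_add₀ h0, zpow_natCast, mul_assoc] at he
  rw [map_mul, map_pow]
  exact mul_left_cancel₀ (zpow_ne_zero _ h0) he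

lemma eq_of_zpow_mul_eq (h : IsIntegersAtOneAddI O K)
    {p q : ℤ} {x y : O} (hx : IsUnit x) (hy : IsUnit y)
    (he : algebraMap O K ϖ ^ p * algebraMap O K x = algebraMap O K ϖ ^ q * algebraMap O K y) :
    p = q ∧ x = y := by
  have key {p q : ℤ} {x y : O} (hx : IsUnit x)
      (he : algebraMap O K ϖ ^ p * algebraMap O K x = algebraMap O K ϖ ^ q * algebraMap O K y) :
      q ≤ p := by
    by_contra! hlt
    obtain ⟨n, hn⟩ := Int.exists_add_of_le hlt.le
    refine h.not_dvd_of_isUnit hx ?_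
    rw [h.eq_pow_mul_of_zpow_mul_eq hn he]
    exact (dvd_pow_self _ (by omega)).mul_right _
  obtain rfl : p = q := le_antisymm (key hy he.symm) (key hx he)
  exact ⟨rfl, by simpa using h.eq_pow_mul_of_zpow_mul_eq (n := 0) (by simp) he⟩

/-- The case of the quartic in which both terms on the right have equal valuation and `w` is
divisible by a high power of `1 + i`, or vanishes. -/
lemma dvd_of_high_valuation (h : IsIntegersAtOneAddI O K)
    {b₀ d₀ : GaussianInt} {td : ℕ} (htd : td ≤ 1) {u : O}
    (hu : IsUnit u)   (hdvd : ϖ ^ 7 ∣ f d₀ ^ 2 + f b₀ * u ^ 4) :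
    ∃ k, 1 ≤ k ∧ k ≤ 4 ∧ ∃ α₀ : GaussianInt, ¬ tt ∣ α₀ ∧
      tt ^ 7 ∣ (b₀ - (-(d₀ * (d₀ - α₀ ^ 2 * tt ^ (2 * k - td))))) := by
  refine ⟨4, by omega, le_rfl, 1, not_tt_dvd_one, h.dvd_of_pow_dvd_map _ _ ?_⟩
  obtain ⟨c, hc⟩ := h.pow_seven_dvd_pow_four_sub_one hu
  obtain ⟨x, hx⟩ := hdvd
  obtain ⟨e, he⟩ : ∃ e, 2 * 4 - td = 7 + e := ⟨1 - td, by omega⟩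
  refine ⟨x - f b₀ * c - f d₀ * ϖ ^ e, ?_⟩
  simp only [he, map_sub, map_mul, map_pow, map_neg, map_one, pow_add]
  linear_combination hx - f b₀ * hc

section Quartic

variable [Algebra GaussianInt K] [IsScalarTower GaussianInt O K]
  {b d b₀ d₀ : GaussianInt} {tb td : ℕ}

lemma quartic_solvable_of_sign (h : IsIntegersAtOneAddI O K)
    (hb0 : b = tt ^ tb * b₀) (hd0 : d = tt ^ td * d₀)
    (hd0odd : ¬ tt ∣ d₀) (hle : td ≤ tb) (hpar : tb % 2 = td % 2) {k : ℕ} {ε : GaussianInt}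
    (hε : ε = 1 ∨ ε = -1)
    (hdvd : tt ^ 5 ∣ b₀ - d₀ * (ε - d₀ * tt ^ (4 * k + tb))) :
    ∃ z w : K, algebraMap GaussianInt K d * w ^ 2
      = algebraMap GaussianInt K d ^ 2 - 4 * algebraMap GaussianInt K b * z ^ 4 := by
  obtain ⟨s, hs⟩ := h.exists_sq_of_dvd hd0odd hε hdvd
  obtain ⟨m, rfl⟩ : ∃ m, tb = td + 2 * m := ⟨(tb - td) / 2, by omega⟩
  have hP := h.map_tt_ne_zero
  have h4 := congrArg (algebraMap O K) (map_tt_pow_four (O := O))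
  replace hs := congrArg (algebraMap O K) hs
  simp only [map_add, map_mul, map_pow, map_neg, map_ofNat] at hs h4
  simp only [IsScalarTower.algebraMap_apply GaussianInt O K, hb0, hd0, map_mul, map_pow]
  generalize algebraMap O K ϖ = P at *
  refine ⟨(P ^ k * P ^ m * P)⁻¹, algebraMap O K s * (P ^ m * P ^ k * P ^ k)⁻¹, ?_⟩
  simp only [pow_add, pow_mul, mul_comm 4 k, mul_comm 2 m] at hs ⊢
  have hk := pow_ne_zero k hP
  have hm := pow_ne_zero m hP
  rw [show (4 : K) = -P ^ 4 by rw [h4, neg_neg]]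
  generalize P ^ k = q at *
  generalize P ^ m = r at *
  generalize P ^ td = t at *
  field_simp
  linear_combination -t * hs

lemma quartic_solvable_of_sign_of_odd (h : IsIntegersAtOneAddI O K)
    (hd0odd : ¬ tt ∣ d) {k : ℕ} {ε : GaussianInt}
    (hε : ε = 1 ∨ ε = -1)
    (hdvd : tt ^ 5 ∣ b * tt ^ (4 * k) - d * (ε - d)) :
    ∃ z w : K, algebraMap GaussianInt K d * w ^ 2
      = algebraMap GaussianInt K d ^ 2 - 4 * algebraMap GaussianInt K b * z ^ 4 := by
  obtain ⟨s, hs⟩ := h.exists_sq_of_dvd hd0odd hε hdvd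
  have hP := h.map_tt_ne_zero
  have h4 := congrArg (algebraMap O K) (map_tt_pow_four (O := O))
  replace hs := congrArg (algebraMap O K) hs
  simp only [map_add, map_mul, map_pow, map_neg, map_ofNat] at hs h4
  simp only [IsScalarTower.algebraMap_apply GaussianInt O K]
  generalize algebraMap O K ϖ = P at *
  refine ⟨P ^ k * P⁻¹, algebraMap O K s, ?_⟩
  rw [show (4 : K) = -P ^ 4 by rw [h4, neg_neg]]
  field_simp
  linear_combination -hs

lemma quartic_solvable_of_odd (h : IsIntegersAtOneAddI O K)
    (hb0 : b = tt ^ (2 * td) * b₀) (hd0 : d = tt ^ td * d₀)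
    (hd0odd : ¬ tt ∣ d₀) {k : ℕ} (hk : td < 2 * k) {α₀ : GaussianInt}
    (hdvd : tt ^ 7 ∣ b₀ - (-(d₀ * (d₀ - α₀ ^ 2 * tt ^ (2 * k - td))))) :
    ∃ z w : K, algebraMap GaussianInt K d * w ^ 2
      = algebraMap GaussianInt K d ^ 2 - 4 * algebraMap GaussianInt K b * z ^ 4 := by
  obtain ⟨c, hc⟩ := hdvd
  have hX : IsUnit (f (-(d₀ * (d₀ - α₀ ^ 2 * tt ^ (2 * k - td))))) := by
    refine h.isUnit_map fun hd => ?_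
    have h1 : tt ∣ α₀ ^ 2 * tt ^ (2 * k - td) := (dvd_pow_self _ (by omega)).mul_left _
    rcases prime_tt.dvd_or_dvd ((dvd_neg).1 hd) with h2 | h2
    · exact hd0odd h2
    · exact hd0odd ((dvd_sub_left h1).1 h2)
  obtain ⟨e, he⟩ : ∃ e, 2 * k = td + e := ⟨2 * k - td, by omega⟩
  obtain ⟨X, hX⟩ := hX.exists_right_inv
  obtain ⟨y, hy⟩ := h.exists_pow_four_eq (X * f c)
  have hy0 : algebraMap O K y ≠ 0 := by
    have hu : IsUnit (y ^ 4) := by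
      rw [hy]
      exact h.isUnit_add isUnit_one ((dvd_pow_self _ (by omega)).mul_right _)
    exact (((isUnit_pow_iff four_ne_zero).1 hu).map (algebraMap O K)).ne_zero
  rw [he, Nat.add_sub_cancel_left] at hc hX
  replace hc := congrArg f hc
  simp only [map_sub, map_mul, map_pow, map_neg] at hc hX
  have hby : f b₀ = -(f d₀ * (f d₀ - f α₀ ^ 2 * ϖ ^ e)) * y ^ 4 := by
    linear_combination hc - ϖ ^ 7 * f c * hX + (f d₀ * (f d₀ - f α₀ ^ 2 * ϖ ^ e)) * hy
  have hP := h.map_tt_ne_zero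
  have h4 := congrArg (algebraMap O K) (map_tt_pow_four (O := O))
  replace hby := congrArg (algebraMap O K) hby
  simp only [map_sub, map_mul, map_pow, map_neg, map_ofNat] at hby h4
  simp only [IsScalarTower.algebraMap_apply GaussianInt O K, hb0, hd0, map_mul, map_pow]
  generalize algebraMap O K ϖ = P at *
  have hke : (P ^ k) ^ 2 = P ^ td * P ^ e := by rw [← pow_mul, ← pow_add, mul_comm k, he]
  refine ⟨(P * algebraMap O K y)⁻¹, P ^ k * algebraMap O K (f α₀), ?_⟩
  rw [show (4 : K) = -P ^ 4 by rw [h4, neg_neg], hby, mul_comm 2, pow_mul, mul_pow, hke]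
  field_simp
  ring

lemma sign_of_div_eq_sq (h : IsIntegersAtOneAddI O K)
    (hb0 : b = tt ^ tb * b₀) (hd0 : d = tt ^ td * d₀)
    (hb0odd : ¬ tt ∣ b₀) (hd0odd : ¬ tt ∣ d₀) {u : K}
    (hu : u ^ 2 * algebraMap GaussianInt K d = algebraMap GaussianInt K b) :
    tb % 2 = td % 2 ∧ ∃ ε : GaussianInt, (ε = 1 ∨ ε = -1) ∧
      tt ^ 5 ∣ b₀ - d₀ * (ε - d₀ * tt ^ (4 * 2 + tb)) := by
  have hB := h.isUnit_map hb0odd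
  have hD := h.isUnit_map hd0odd
  have hP := h.map_tt_ne_zero
  have hu0 : u ≠ 0 := by
    rintro rfl
    have : algebraMap O K (f b) = 0 := by
      rw [← IsScalarTower.algebraMap_apply, ← hu]; ring
    rw [hb0, map_mul, map_pow, map_mul, map_pow] at this
    exact mul_ne_zero (pow_ne_zero _ hP) (hB.map _).ne_zero this
  obtain ⟨n, s, hs, rfl⟩ := h.exists_eq_zpow_mul u hu0
  have hE : algebraMap O K ϖ ^ ((tb : ℕ) : ℤ) * algebraMap O K (f b₀)
      = algebraMap O K ϖ ^ (td + 2 * n) * algebraMap O K (f d₀ * s ^ 2) := by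
    simp only [IsScalarTower.algebraMap_apply GaussianInt O K, hb0, hd0, map_mul, map_pow] at hu
    rw [zpow_add₀ hP, mul_comm 2 n, zpow_mul]
    simp only [zpow_natCast, zpow_ofNat, map_mul, map_pow]
    linear_combination -hu
  obtain ⟨h1, h2⟩ := h.eq_of_zpow_mul_eq hB (hD.mul (hs.pow 2)) hE
  refine ⟨by omega, h.exists_sign_dvd hs ?_⟩
  rw [h2, map_mul, map_pow, pow_add]
  exact ⟨f d₀ * f d₀ * ϖ ^ 3 * ϖ ^ tb, by ring⟩

lemma congruences_of_quartic_solution (h : IsIntegersAtOneAddI O K)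
    (htd : td ≤ 1) (hle : td ≤ tb) (htb : tb ≤ 3)
    (hb0 : b = tt ^ tb * b₀) (hd0 : d = tt ^ td * d₀)
    (hb0odd : ¬ tt ∣ b₀) (hd0odd : ¬ tt ∣ d₀) {z w : K}
    (hzw : algebraMap GaussianInt K d * w ^ 2
      = algebraMap GaussianInt K d ^ 2 - 4 * algebraMap GaussianInt K b * z ^ 4) :
    SolubilityCongruences b b₀ d₀ tb td := by
  have hB := h.isUnit_map hb0odd
  have hD := h.isUnit_map hd0odd
  have hP := h.map_tt_ne_zero
  have hD0 := (hD.map (algebraMap O K)).ne_zero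
  have h4 := congrArg (algebraMap O K) (map_tt_pow_four (O := O))
  simp only [map_pow, map_neg, map_ofNat] at h4
  simp only [IsScalarTower.algebraMap_apply GaussianInt O K, map_mul, map_pow, hd0] at hzw
  rw [show algebraMap O K (f b) = algebraMap O K ϖ ^ tb * algebraMap O K (f b₀) by
    simp [hb0], show (4 : K) = -algebraMap O K ϖ ^ 4 by rw [h4, neg_neg]] at hzw
  by_cases hz : z = 0
  · have hw : w ≠ 0 := by
      rintro rfl
      have : (algebraMap O K ϖ ^ td * algebraMap O K (f d₀)) ^ 2 = 0 := by
        linear_combination -hzw - algebraMap O K ϖ ^ 4 *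
          (algebraMap O K ϖ ^ tb * algebraMap O K (f b₀)) * z ^ 3 * hz
      exact pow_ne_zero _ (mul_ne_zero (pow_ne_zero _ hP) hD0) this
    obtain ⟨n, s, hs, rfl⟩ := h.exists_eq_zpow_mul w hw
    have hE : algebraMap O K ϖ ^ (2 * n) * algebraMap O K (s ^ 2)
        = algebraMap O K ϖ ^ ((td : ℕ) : ℤ) * algebraMap O K (f d₀) := by
      rw [mul_comm 2 n, zpow_mul]
      simp only [zpow_natCast, zpow_ofNat, map_pow]
      refine mul_left_cancel₀ (mul_ne_zero (pow_ne_zero td hP) hD0) ?_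
      rw [hz] at hzw
      linear_combination hzw
    obtain ⟨h1, h2⟩ := h.eq_of_zpow_mul_eq (hs.pow 2) hD hE
    obtain rfl : td = 0 := by omega
    refine .inr (.inl ⟨rfl, 2, le_rfl, h.exists_sign_dvd hs ?_⟩)
    rw [h2, map_mul, map_pow]
    exact ⟨f b * ϖ ^ 3, by ring⟩
  obtain ⟨m, u, hu, hmu⟩ := h.exists_eq_zpow_mul (algebraMap O K ϖ * z) (mul_ne_zero hP hz)
  have hE0 : algebraMap O K ϖ ^ ((td : ℕ) : ℤ) * (algebraMap O K (f d₀) * w ^ 2)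
      = algebraMap O K ϖ ^ (2 * (td : ℤ)) * algebraMap O K (f d₀ ^ 2)
        + algebraMap O K ϖ ^ (tb + 4 * m) * algebraMap O K (f b₀ * u ^ 4) := by
    rw [zpow_add₀ hP, mul_comm 4 m, mul_comm 2 (td : ℤ), zpow_mul, zpow_mul]
    simp only [zpow_natCast, zpow_ofNat, map_pow, map_mul]
    have : (algebraMap O K ϖ * z) ^ 4 = (algebraMap O K ϖ ^ m) ^ 4 * algebraMap O K u ^ 4 := by
      rw [hmu, mul_pow]
    linear_combination hzw + algebraMap O K ϖ ^ tb * algebraMap O K (f b₀) * this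
  obtain ⟨c4, hc4⟩ := h.pow_seven_dvd_pow_four_sub_one hu
  by_cases hw : w = 0
  · have hE : algebraMap O K ϖ ^ (2 * (td : ℤ)) * algebraMap O K (f d₀ ^ 2)
        = algebraMap O K ϖ ^ (tb + 4 * m) * algebraMap O K (-(f b₀ * u ^ 4)) := by
      rw [hw] at hE0
      rw [map_neg]
      linear_combination -hE0
    obtain ⟨h1, h2⟩ := h.eq_of_zpow_mul_eq (hD.pow 2) (hB.mul (hu.pow 4)).neg hE
    refine .inr (.inr ⟨by omega, h.dvd_of_high_valuation htd hu ?_⟩)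
    rw [h2, neg_add_cancel]
    exact dvd_zero _
  obtain ⟨n, s, hs, rfl⟩ := h.exists_eq_zpow_mul w hw
  have hE : algebraMap O K ϖ ^ (td + 2 * n) * algebraMap O K (f d₀ * s ^ 2)
      = algebraMap O K ϖ ^ (2 * (td : ℤ)) * algebraMap O K (f d₀ ^ 2)
        + algebraMap O K ϖ ^ (tb + 4 * m) * algebraMap O K (f b₀ * u ^ 4) := by
    rw [← hE0, zpow_add₀ hP, mul_comm 2 n, zpow_mul]
    simp only [zpow_natCast, zpow_ofNat, map_mul, map_pow]
    ring
  clear hE0 hzw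
  have hDs := hD.mul (hs.pow 2)
  have hBu := hB.mul (hu.pow 4)
  rcases lt_trichotomy (tb + 4 * m) (2 * td : ℤ) with hlt | heq | hgt
  · obtain ⟨e, he⟩ := Int.exists_add_of_le hlt.le
    have he0 : e ≠ 0 := by omega
    replace hE : algebraMap O K ϖ ^ (td + 2 * n) * algebraMap O K (f d₀ * s ^ 2)
        = algebraMap O K ϖ ^ (tb + 4 * m) * algebraMap O K (f b₀ * u ^ 4 + ϖ ^ e * f d₀ ^ 2) := by
      rw [hE, he, zpow_add₀ hP _ (e : ℤ), zpow_natCast, map_add, map_mul _ (ϖ ^ e), map_pow _ ϖ]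
      ring
    obtain ⟨h1, h2⟩ := h.eq_of_zpow_mul_eq hDs (h.isUnit_add hBu
      ((dvd_pow_self _ he0).mul_right _)) hE
    refine .inl ⟨by omega, ?_⟩
    obtain ⟨k, hk, x, hx⟩ : ∃ k ≤ 2, ϖ ^ 5 ∣ ϖ ^ (4 * k + tb) - ϖ ^ e := by
      by_cases hbig : e ≤ 8 + tb
      · obtain ⟨k, rfl⟩ : ∃ k, e = 4 * k + tb := ⟨(e - tb) / 4, by omega⟩
        exact ⟨k, by omega, by simp⟩
      · exact ⟨2, le_rfl, dvd_sub (pow_dvd_pow _ (by omega)) (pow_dvd_pow _ (by omega))⟩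
    refine ⟨k, hk, h.exists_sign_dvd hs ⟨f d₀ ^ 2 * x - f b₀ * ϖ ^ 2 * c4, ?_⟩⟩
    rw [map_mul, map_pow]
    linear_combination f d₀ ^ 2 * hx - f b₀ * hc4 - h2
  · obtain rfl : tb = 2 * td := by omega
    rw [heq, ← mul_add, ← map_add] at hE
    refine .inr (.inr ⟨rfl, ?_⟩)
    have hlt : (2 * td : ℤ) < td + 2 * n := by
      by_contra! hle
      obtain ⟨e, he⟩ := Int.exists_add_of_le hle
      refine h.not_dvd_of_isUnit hDs ?_
      rw [h.eq_pow_mul_of_zpow_mul_eq he hE]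
      exact (h.dvd_add_of_isUnit (hD.pow 2) hBu).mul_left _
    obtain ⟨e, he⟩ := Int.exists_add_of_le hlt.le
    have h2 := h.eq_pow_mul_of_zpow_mul_eq he hE.symm
    by_cases hn : n ≤ 4
    · lift n to ℕ using by omega
      obtain ⟨α, hα⟩ := h.exists_pow_dvd_sub_map 7 s
      refine ⟨n, by omega, by omega, α, fun hd => h.not_dvd_of_isUnit hs ?_,
        h.dvd_of_pow_dvd_map _ _ ?_⟩
      · exact (dvd_sub_left (map_dvd f hd)).1 ((dvd_pow_self _ (by omega)).trans hα)
      · obtain ⟨x, hx⟩ := hα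
        obtain rfl : e = 2 * n - td := by omega
        refine ⟨-f b₀ * c4 + f d₀ * (s + f α) * x * ϖ ^ (2 * n - td), ?_⟩
        simp only [map_sub, map_mul, map_pow, map_neg]
        linear_combination h2 - f b₀ * hc4 + f d₀ * (s + f α) * ϖ ^ (2 * n - td) * hx
    · refine h.dvd_of_high_valuation htd hu ?_
      rw [h2]
      exact (pow_dvd_pow _ (by omega)).mul_right _
  · obtain ⟨e, he⟩ := Int.exists_add_of_le hgt.le
    have he0 : e ≠ 0 := by omega
    replace hE : algebraMap O K ϖ ^ (td + 2 * n) * algebraMap O K (f d₀ * s ^ 2)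
        = algebraMap O K ϖ ^ (2 * td : ℤ)
          * algebraMap O K (f d₀ ^ 2 + ϖ ^ e * (f b₀ * u ^ 4)) := by
      rw [hE, he, zpow_add₀ hP _ (e : ℤ), zpow_natCast, map_add, map_mul _ (ϖ ^ e), map_pow _ ϖ]
      ring
    obtain ⟨h1, h2⟩ := h.eq_of_zpow_mul_eq hDs (h.isUnit_add (hD.pow 2)
      ((dvd_pow_self _ he0).mul_right _)) hE
    obtain rfl : td = 0 := by omega
    lift m to ℕ using by omega
    obtain rfl : e = tb + 4 * m := by omega
    refine .inr (.inl ⟨rfl, ?_⟩)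
    obtain ⟨k, hk, x, hx⟩ : ∃ k ≤ 2, ϖ ^ 5 ∣ ϖ ^ (tb + 4 * k) - ϖ ^ (tb + 4 * m) := by
      by_cases hbig : m ≤ 2
      · exact ⟨m, hbig, by simp⟩
      · exact ⟨2, le_rfl, dvd_sub (pow_dvd_pow _ (by omega)) (pow_dvd_pow _ (by omega))⟩
    refine ⟨k, hk, h.exists_sign_dvd hs
      ⟨f b₀ * x - f b₀ * ϖ ^ (tb + 4 * m) * ϖ ^ 2 * c4, ?_⟩⟩
    rw [map_mul, hb0, map_mul, map_pow, map_pow]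
    linear_combination f b₀ * hx - f b₀ * ϖ ^ (tb + 4 * m) * hc4 - h2

/-- Solubility of `C_d` over the completion is equivalent to the congruence conditions. -/
theorem quartic_solvable_iff (h : IsIntegersAtOneAddI O K)
    (htd : td ≤ 1) (hle : td ≤ tb) (htb : tb ≤ 3)
    (hb0 : b = tt ^ tb * b₀) (hd0 : d = tt ^ td * d₀)
    (hb0odd : ¬ tt ∣ b₀) (hd0odd : ¬ tt ∣ d₀) :
    ((∃ z w : K, algebraMap GaussianInt K d * w ^ 2
        = algebraMap GaussianInt K d ^ 2 - 4 * algebraMap GaussianInt K b * z ^ 4) ∨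
      ∃ u : K, u ^ 2 * algebraMap GaussianInt K d = algebraMap GaussianInt K b) ↔
    SolubilityCongruences b b₀ d₀ tb td := by
  constructor
  · rintro (⟨z, w, hzw⟩ | ⟨u, hu⟩)
    · exact h.congruences_of_quartic_solution htd hle htb hb0 hd0 hb0odd hd0odd hzw
    · obtain ⟨h1, h2⟩ := h.sign_of_div_eq_sq hb0 hd0 hb0odd hd0odd hu
      exact .inl ⟨h1, 2, le_rfl, h2⟩
  · rintro (⟨hpar, k, -, ε, hε, hd⟩ | ⟨rfl, k, -, ε, hε, hd⟩ | ⟨rfl, k, hk, -, α₀, -, hd⟩)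
    · exact .inl (h.quartic_solvable_of_sign hb0 hd0 hd0odd hle hpar hε hd)
    · obtain rfl : d = d₀ := by simpa using hd0
      exact .inl (h.quartic_solvable_of_sign_of_odd hd0odd hε hd)
    · exact .inl (h.quartic_solvable_of_odd hb0 hd0 hd0odd (by omega) hd)

end Quartic

end IsIntegersAtOneAddI

section Completion

open HeightOneSpectrum WithZero Filter Topology

variable {v : HeightOneSpectrum GaussianInt}

local notation "Kᵥ" => v.adicCompletion (FractionRing GaussianInt)
local notation "Oᵥ" => v.adicCompletionIntegers (FractionRing GaussianInt)

lemma valued_algebraMap_fractionRing (k : FractionRing GaussianInt) :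
    Valued.v (algebraMap (FractionRing GaussianInt) Kᵥ k) =
      v.valuation (FractionRing GaussianInt) k :=
  valuedAdicCompletion_eq_valuation' v k

lemma coe_algebraMap_adicCompletionIntegers (a : GaussianInt) :
    ((algebraMap GaussianInt Oᵥ a : Oᵥ) : Kᵥ) = algebraMap (FractionRing GaussianInt) Kᵥ
      (algebraMap GaussianInt (FractionRing GaussianInt) a) :=
  rfl

lemma valued_map_tt (hv : v.asIdeal = Ideal.span {tt}) :
    Valued.v ((algebraMap GaussianInt Oᵥ tt : Oᵥ) : Kᵥ) = exp (-1 : ℤ) := by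
  rw [coe_algebraMap_adicCompletionIntegers, valued_algebraMap_fractionRing,
    v.valuation_of_algebraMap, v.intValuation_singleton tt_ne_zero hv]

lemma map_tt_dvd_iff (hv : v.asIdeal = Ideal.span {tt}) (x : Oᵥ) :
    algebraMap GaussianInt Oᵥ tt ∣ x ↔ Valued.v (x : Kᵥ) < 1 := by
  have hπ := valued_map_tt hv
  constructor
  · rintro ⟨c, rfl⟩
    have hc := c.2
    rw [mem_adicCompletionIntegers] at hc
    rw [MulMemClass.coe_mul, map_mul, hπ]
    calc _ ≤ exp (-1 : ℤ) * 1 := by gcongr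
      _ < 1 := by rw [mul_one, ← exp_zero, exp_lt_exp]; norm_num
  · intro hx
    have h0 : ((algebraMap GaussianInt Oᵥ tt : Oᵥ) : Kᵥ) ≠ 0 := by
      intro h0
      rw [h0, map_zero] at hπ
      exact exp_ne_zero hπ.symm
    refine ⟨⟨(x : Kᵥ) / (algebraMap GaussianInt Oᵥ tt : Oᵥ), ?_⟩, ?_⟩
    · rw [mem_adicCompletionIntegers, map_div₀, hπ]
      rcases eq_or_ne (Valued.v (x : Kᵥ)) 0 with h | h
      · simp [h]
      · rw [← exp_log h, ← exp_zero, exp_lt_exp] at hx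
        rw [← exp_log h, ← exp_sub, ← exp_zero, exp_le_exp]
        omega
    · refine Subtype.ext ?_
      rw [MulMemClass.coe_mul]
      exact (mul_div_cancel₀ _ h0).symm

lemma exists_eq_add_mul_sq_of_valued (hv : v.asIdeal = Ideal.span {tt}) (a c : Oᵥ) :
    ∃ z : Oᵥ, z = c + algebraMap GaussianInt Oᵥ tt * a * z ^ 2 := by
  have hπ := valued_map_tt hv
  set p : Oᵥ := algebraMap GaussianInt Oᵥ tt
  let z : ℕ → Oᵥ := fun n => (fun y => c + p * a * y ^ 2)^[n] 0
  have hz (n : ℕ) : z (n + 1) = c + p * a * z n ^ 2 := Function.iterate_succ_apply' _ _ _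
  have hstep (n : ℕ) : p ^ n ∣ z (n + 1) - z n := by
    induction n with
    | zero => simp
    | succ n ih =>
      have : z (n + 1 + 1) - z (n + 1) = p * ((z (n + 1) - z n) * (a * (z (n + 1) + z n))) := by
        rw [hz (n + 1), hz n]; ring
      rw [this, pow_succ']
      exact mul_dvd_mul_left p (ih.mul_right _)
  have hdvd (n m : ℕ) (hnm : n ≤ m) : p ^ n ∣ z m - z n := by
    induction m, hnm using Nat.le_induction with
    | base => simp
    | succ m hnm ih =>
      rw [← sub_add_sub_cancel (z (m + 1)) (z m)]
      exact dvd_add ((pow_dvd_pow p hnm).trans (hstep m)) ih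
  have hval (n : ℕ) (x : Oᵥ) (hx : p ^ n ∣ x) : Valued.v (x : Kᵥ) ≤ exp (-n : ℤ) := by
    obtain ⟨e, rfl⟩ := hx
    rw [MulMemClass.coe_mul, SubmonoidClass.coe_pow, map_mul, map_pow, hπ, ← exp_nsmul]
    calc _ ≤ exp (n • (-1 : ℤ)) * 1 := by gcongr; exact e.2
      _ = exp (-n : ℤ) := by simp
  have hcauchy : CauchySeq fun n => (z n : Kᵥ) := by
    refine Valued.cauchy_iff.2 ⟨inferInstance, fun γ => ?_⟩
    set g := MonoidWithZeroHom.ValueGroup₀.embedding γ.1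
    have hg : g ≠ 0 := (map_ne_zero _).2 γ.ne_zero
    set n := (1 - log g).toNat
    refine ⟨_, image_mem_map (mem_atTop n), ?_⟩
    rintro _ ⟨k, hk, rfl⟩ _ ⟨l, hl, rfl⟩
    rw [Valuation.restrict_lt_iff_lt_embedding]
    have hkl : p ^ n ∣ z l - z k := by
      rw [← sub_sub_sub_cancel_right _ _ (z n)]
      exact dvd_sub (hdvd n l hl) (hdvd n k hk)
    refine (hval n _ hkl).trans_lt ?_
    change _ < g
    rw [← exp_log hg, exp_lt_exp]
    omega
  obtain ⟨y, hy⟩ := cauchySeq_tendsto_of_complete hcauchy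
  have hyO : y ∈ Oᵥ := (Valued.isClosed_valuationSubring Kᵥ).mem_of_tendsto hy
    (Eventually.of_forall fun n => (z n).2)
  refine ⟨⟨y, hyO⟩, Subtype.ext ?_⟩
  have hlim : Tendsto (fun n => (z (n + 1) : Kᵥ)) atTop (𝓝 (c + p * a * y ^ 2)) := by
    simp only [hz]
    exact tendsto_const_nhds.add (tendsto_const_nhds.mul (hy.pow 2))
  exact tendsto_nhds_unique ((tendsto_add_atTop_iff_nat 1).2 hy) hlim

lemma isIntegersAtOneAddI_adicCompletion (hv : v.asIdeal = Ideal.span {tt}) :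
    IsIntegersAtOneAddI Oᵥ Kᵥ where
  injective := Subtype.val_injective
  map_ne_zero := by
    intro h0
    have hπ := valued_map_tt hv
    rw [h0, ZeroMemClass.coe_zero, map_zero] at hπ
    exact exp_ne_zero hπ.symm
  dvd_of_dvd_map a ha := by
    rwa [map_tt_dvd_iff hv, coe_algebraMap_adicCompletionIntegers, valued_algebraMap_fractionRing,
      valuation_lt_one_iff_mem, hv, Ideal.mem_span_singleton] at ha
  dvd_or_dvd_sub_one x := by
    have hnhds : {y : Kᵥ | Valued.v (y - x) < 1} ∈ 𝓝 (x : Kᵥ) :=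
      Valued.mem_nhds.2 ⟨1, fun y hy => Valued.v.restrict_lt_one_iff.1 hy⟩
    obtain ⟨_, hk, k, rfl⟩ := mem_closure_iff_nhds.1
      (denseRange_algebraMap (FractionRing GaussianInt) v x) _ hnhds
    have hk1 : v.valuation (FractionRing GaussianInt) k ≤ 1 := by
      rw [← valued_algebraMap_fractionRing]
      have := Valuation.map_add_le Valued.v (le_of_lt hk) ((mem_adicCompletionIntegers ..).1 x.2)
      rwa [sub_add_cancel] at this
    obtain ⟨a, ha⟩ := v.exists_valuation_sub_lt_of_integer hk1 1
    have hax : algebraMap GaussianInt Oᵥ tt ∣ algebraMap GaussianInt Oᵥ a - x := by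
      rw [Units.val_one, ← valued_algebraMap_fractionRing, map_sub] at ha
      have := Valuation.map_add_lt Valued.v ha hk
      rwa [sub_add_sub_cancel, ← coe_algebraMap_adicCompletionIntegers, ← AddSubgroupClass.coe_sub,
        ← map_tt_dvd_iff hv] at this
    rcases tt_dvd_or_dvd_sub_one a with h | h
    · left
      rw [← sub_sub_cancel (algebraMap GaussianInt Oᵥ a) x]
      exact dvd_sub (map_dvd _ h) hax
    · right
      have := dvd_sub (map_dvd (algebraMap GaussianInt Oᵥ) h) hax
      rwa [map_sub, map_one, sub_sub_sub_cancel_left] at this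
  isUnit_of_not_dvd x hx := by
    rw [map_tt_dvd_iff hv, not_lt] at hx
    exact adicCompletionIntegers.isUnit_iff_valued_eq_one.2 (le_antisymm x.2 hx)
  exists_eq_add_mul_sq a c := exists_eq_add_mul_sq_of_valued hv a c
  exists_eq_zpow_mul x hx := by
    have hπ := valued_map_tt hv
    have hx0 : Valued.v x ≠ 0 := (map_ne_zero _).2 hx
    obtain ⟨n, hn⟩ : ∃ n : ℤ, Valued.v x = exp (-n) :=
      ⟨-log (Valued.v x), by rw [neg_neg, exp_log hx0]⟩
    have h0 : ((algebraMap GaussianInt Oᵥ tt : Oᵥ) : Kᵥ) ≠ 0 := by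
      intro h0
      rw [h0, map_zero] at hπ
      exact exp_ne_zero hπ.symm
    have hu : Valued.v (x / ((algebraMap GaussianInt Oᵥ tt : Oᵥ) : Kᵥ) ^ n) = 1 := by
      rw [map_div₀, map_zpow₀, hπ, hn, ← exp_zsmul]
      simp
    refine ⟨n, ⟨_, hu.le⟩, adicCompletionIntegers.isUnit_iff_valued_eq_one.2 hu, ?_⟩
    exact (mul_div_cancel₀ _ (zpow_ne_zero n h0)).symm

end Completion

/-- **Statement 10.**  Let `b ∈ ℤ[i]` be nonzero and fourth-power-free, and `d` a square-free
divisor of `b`.  Write `b = (1+i)^{t_b}·b₀` and `d = (1+i)^{t_d}·d₀` with `b₀, d₀` odd.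
Then `C_d(ℚ(i)_{(1+i)}) ≠ ∅` iff one of the following holds:
(A) `t_b ≡ t_d (mod 2)` and `b₀ ≡ d₀(ε − d₀(1+i)^{4k+t_b}) (mod (1+i)⁵)` for some
    `k ∈ {0,1,2}`, `ε ∈ {±1}`;
(B) `t_d = 0` and `b·(1+i)^{4k} ≡ d₀(ε − d₀) (mod (1+i)⁵)` for some `k ∈ {0,1,2}`, `ε ∈ {±1}`;
(C) `t_b = 2t_d` and `b₀ ≡ −d₀(d₀ − α₀²(1+i)^{2k−t_d}) (mod (1+i)⁷)` for some `k ∈ {1,2,3,4}`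
    and odd `α₀ ∈ ℤ[i]`. -/
theorem local_solubility_at_one_add_i (b d b₀ d₀ : GaussianInt) (tb td : ℕ)
    (hbne : b ≠ 0) (hb4 : FourthPowerFree b) (hd : Squarefree d) (hdvd : d ∣ b)
    (hb0 : b = tt ^ tb * b₀) (hb0odd : ¬ tt ∣ b₀)
    (hd0 : d = tt ^ td * d₀) (hd0odd : ¬ tt ∣ d₀) :
    HasLocalPoint b d tt ↔
      ((tb % 2 = td % 2 ∧ ∃ k ≤ 2, ∃ ε : GaussianInt, (ε = 1 ∨ ε = -1) ∧
          tt ^ 5 ∣ (b₀ - d₀ * (ε - d₀ * tt ^ (4 * k + tb)))) ∨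
       (td = 0 ∧ ∃ k ≤ 2, ∃ ε : GaussianInt, (ε = 1 ∨ ε = -1) ∧
          tt ^ 5 ∣ (b * tt ^ (4 * k) - d₀ * (ε - d₀))) ∨
       (tb = 2 * td ∧ ∃ k, 1 ≤ k ∧ k ≤ 4 ∧ ∃ α₀ : GaussianInt, ¬ tt ∣ α₀ ∧
          tt ^ 7 ∣ (b₀ - (-(d₀ * (d₀ - α₀ ^ 2 * tt ^ (2 * k - td))))))) := by
  have htd : td ≤ 1 := by
    by_contra! h
    refine prime_tt.not_isUnit (hd tt ?_)
    rw [← sq, hd0]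
    exact (pow_dvd_pow tt h).mul_right _
  have htb : tb ≤ 3 := by
    by_contra! h
    refine hb4 tt prime_tt ?_
    rw [hb0]
    exact (pow_dvd_pow tt h).mul_right _
  have hle : td ≤ tb := by
    by_contra! h
    have : tt ^ (tb + 1) ∣ tt ^ tb * b₀ := by
      rw [← hb0]
      exact ((pow_dvd_pow tt h).trans (hd0 ▸ dvd_mul_right _ _)).trans hdvd
    rw [pow_succ] at this
    exact hb0odd ((mul_dvd_mul_iff_left (pow_ne_zero tb tt_ne_zero)).1 this)
  have key (v : HeightOneSpectrum GaussianInt) (hv : v.asIdeal = Ideal.span {tt}) :=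
    (isIntegersAtOneAddI_adicCompletion hv).quartic_solvable_iff htd hle htb hb0 hd0 hb0odd hd0odd
  exact ⟨fun h => (key ⟨Ideal.span {tt}, (Ideal.span_singleton_prime tt_ne_zero).2 prime_tt,
    by simp [tt_ne_zero]⟩ rfl).1 (h _ rfl), fun h v hv => (key v hv).2 h⟩
end
end
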